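/- arXiv:1901.10038 — 4 statements merged into one kernel-verified Lean document; each statement's English description precedes it below -/
import Mathlib

section
/- Let μ = (μ₁) be the partition of N = μ₁ with a single part. Then for every integer d ≥ 0, the connected and nonconnected weighted Hurwitz numbers coincide and are given by H̃^d_G((μ₁)) = H^d_G((μ₁)) = (1/μ₁) · Σ_{a=0}^{μ₁−1} ρ^d_{a, μ₁−a−1}. -/
open scoped BigOperators

namespace WHN

/-- The cycle type of a permutation of `Fin N`, including fixed points as cycles of length 1. -/
def fullCycleType {N : ℕ} (h : Equiv.Perm (Fin N)) : Multiset ℕ :=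
  h.cycleType + Multiset.replicate (N - h.cycleType.sum) 1

/-- The number of cycles of a permutation of `Fin N`, including fixed points. -/
def numCycles {N : ℕ} (h : Equiv.Perm (Fin N)) : ℕ :=
  (fullCycleType h).card

/-- The pure Hurwitz number `H(μ⁽¹⁾, …, μ⁽ᵏ⁾)`:  `1/N!` times the number of `k`-tuples of
permutations of `{1,…,N}` with the prescribed cycle types whose product is the identity. -/
noncomputable def pureHurwitz {N k : ℕ} (μ : Fin k → N.Partition) : ℚ :=
  (Nat.card {h : Fin k → Equiv.Perm (Fin N) //
      (∀ i, fullCycleType (h i) = (μ i).parts) ∧ (List.ofFn h).prod = 1} : ℚ)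
    / N.factorial

/-- The connected pure Hurwitz number `H̃(μ⁽¹⁾, …, μ⁽ᵏ⁾)`: only tuples generating a
transitive subgroup are counted. -/
noncomputable def connHurwitz {N k : ℕ} (μ : Fin k → N.Partition) : ℚ :=
  (Nat.card {h : Fin k → Equiv.Perm (Fin N) //
      (∀ i, fullCycleType (h i) = (μ i).parts) ∧ (List.ofFn h).prod = 1 ∧
      ∀ x y : Fin N, ∃ g ∈ Subgroup.closure (Set.range h), g x = y} : ℚ)
    / N.factorial

/-- The colength `ℓ*(ν) = N - ℓ(ν)` of a partition `ν` of `N`. -/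
def colength {N : ℕ} (ν : N.Partition) : ℕ := N - ν.parts.card

/-- `F_λ(μ)`: the sum of the pure Hurwitz numbers `H(μ⁽¹⁾, …, μ⁽ᵏ⁾, μ)` over all `k`-tuples of
partitions of `N` with colengths `ℓ*(μ⁽ʲ⁾) = ℓ j`. -/
noncomputable def Fsum (N : ℕ) (μ : N.Partition) {k : ℕ} (ℓ : Fin k → ℕ) : ℚ :=
  ∑ ν ∈ Finset.univ.filter (fun ν : Fin k → N.Partition => ∀ j, colength (ν j) = ℓ j),
    pureHurwitz (Fin.snoc ν μ)

/-- `F̃_λ(μ)`: connected version of `Fsum`. -/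
noncomputable def Fconn (N : ℕ) (μ : N.Partition) {k : ℕ} (ℓ : Fin k → ℕ) : ℚ :=
  ∑ ν ∈ Finset.univ.filter (fun ν : Fin k → N.Partition => ∀ j, colength (ν j) = ℓ j),
    connHurwitz (Fin.snoc ν μ)

/-- The parts of a partition, sorted in weakly decreasing order `λ₁ ≥ λ₂ ≥ ⋯ ≥ λ_k`. -/
def sortedParts {d : ℕ} (lam : d.Partition) : List ℕ := lam.parts.sort (· ≥ ·)

/-- The evaluation `m_λ(c₁,…,c_L)` of the monomial symmetric polynomial in `L` variables. -/
noncomputable def msymmEval {R : Type*} [CommSemiring R] {L : ℕ} (c : Fin L → R) {d : ℕ}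
    (lam : d.Partition) : R :=
  MvPolynomial.eval c (MvPolynomial.msymm (Fin L) R lam)

/-- The weighted Hurwitz number `H^d_G(μ) = Σ_{λ ⊢ d} m_λ(c) F_λ(μ)` for the weight
generating function `G(z) = ∏_{j=1}^L (1 + c_j z)`. -/
noncomputable def weightedH {R : Type*} [CommRing R] [Algebra ℚ R] {L : ℕ} (c : Fin L → R)
    (d : ℕ) {N : ℕ} (μ : N.Partition) : R :=
  ∑ lam : d.Partition,
    msymmEval c lam * algebraMap ℚ R (Fsum N μ fun j => (sortedParts lam).get j)

/-- The connected weighted Hurwitz number `H̃^d_G(μ) = Σ_{λ ⊢ d} m_λ(c) F̃_λ(μ)`. -/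
noncomputable def weightedHconn {R : Type*} [CommRing R] [Algebra ℚ R] {L : ℕ} (c : Fin L → R)
    (d : ℕ) {N : ℕ} (μ : N.Partition) : R :=
  ∑ lam : d.Partition,
    msymmEval c lam * algebraMap ℚ R (Fconn N μ fun j => (sortedParts lam).get j)

/-- The coefficient `ρ^d_{ab}` of `β^d` in
`ρ_{ab}(β) = (−1)^b (a! b! (a+b+1))⁻¹ ∏_{i=−b}^{a} G(iβ)`, for `G(z) = ∏_j (1 + c_j z)`. -/
noncomputable def rhoCoeff {R : Type*} [CommRing R] [Algebra ℚ R] {L : ℕ} (c : Fin L → R)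
    (a b d : ℕ) : R :=
  algebraMap ℚ R ((-1 : ℚ) ^ b * ((a.factorial * b.factorial * (a + b + 1) : ℕ) : ℚ)⁻¹) *
    (∏ i ∈ Finset.Icc (-(b : ℤ)) (a : ℤ),
        ∏ j, (1 + Polynomial.C ((i : R) * c j) * Polynomial.X)).coeff d

/-- The partition `(1^N)` of `N` with all parts equal to `1`. -/
def onesPartition (N : ℕ) : N.Partition :=
  ⟨Multiset.replicate N 1, fun hi => by simp [Multiset.eq_of_mem_replicate hi], by simp⟩

/-- The one-part partition `(μ₁)` of `μ₁`. -/
def part1 (m1 : ℕ) : m1.Partition := Nat.Partition.indiscrete m1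

/-- The two-part partition `(μ₁, μ₂)` of `μ₁ + μ₂`. -/
def part2 (m1 m2 : ℕ) (h1 : 0 < m1) (h2 : 0 < m2) : (m1 + m2).Partition :=
  ⟨{m1, m2}, fun hi => by
      rcases Multiset.mem_cons.mp hi with h | h
      · simpa [h] using h1
      · simp only [Multiset.mem_singleton] at h; simpa [h] using h2, by
    simp [Multiset.sum_cons]⟩

/-- The three-part partition `(μ₁, μ₂, μ₃)` of `μ₁ + μ₂ + μ₃`. -/
def part3 (m1 m2 m3 : ℕ) (h1 : 0 < m1) (h2 : 0 < m2) (h3 : 0 < m3) :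
    (m1 + m2 + m3).Partition :=
  ⟨{m1, m2, m3}, fun hi => by
      rcases Multiset.mem_cons.mp hi with h | h
      · simpa [h] using h1
      rcases Multiset.mem_cons.mp h with h' | h'
      · simpa [h'] using h2
      · simp only [Multiset.mem_singleton] at h'; simpa [h'] using h3, by
    simp [Multiset.sum_cons]; ring⟩

/-- `|aut(λ)| = ∏_i m_i(λ)!` where `m_i(λ)` is the multiplicity of `i`. -/
def autCard (m : Multiset ℕ) : ℕ :=
  m.toFinset.prod fun i => (m.count i).factorial

end WHN

namespace WHN

open Equiv Equiv.Perm

section Colength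

variable {α : Type*} [Fintype α] [DecidableEq α]

/-- The colength `|α| - #cycles` of a permutation, as the sum of `length - 1` over its cycles. -/
def permColength (σ : Perm α) : ℕ := (σ.cycleType.map (· - 1)).sum

lemma permColength_one : permColength (1 : Perm α) = 0 := by
  simp [permColength]

lemma Disjoint.permColength_mul {σ τ : Perm α} (h : σ.Disjoint τ) :
    permColength (σ * τ) = permColength σ + permColength τ := by
  simp [permColength, h.cycleType_mul]

lemma permColength_isCycle {σ : Perm α} (h : σ.IsCycle) :
    permColength σ = σ.support.card - 1 := by
  simp [permColength, h.cycleType]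

/-- Splitting a non-fixed point off its cycle lowers the colength by one. -/
lemma permColength_swap_mul {σ : Perm α} {a : α} (ha : σ a ≠ a) :
    permColength σ = permColength (swap a (σ a) * σ) + 1 := by
  set c := σ.cycleOf a with hc
  have hcyc : c.IsCycle := isCycle_cycleOf σ ha
  have hca : c a = σ a := cycleOf_apply_self σ a
  have hdis : c.Disjoint (c⁻¹ * σ) := by
    have := disjoint_mul_inv_of_mem_cycleFactorsFinset
      (cycleOf_mem_cycleFactorsFinset_iff.2 (mem_support.2 ha))
    rw [← hc] at this
    have hcomm : Commute c σ := by
      rw [hc]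
      exact (self_mem_cycle_factors_commute
        (cycleOf_mem_cycleFactorsFinset_iff.2 (mem_support.2 ha)))
    rw [(hcomm.inv_left).eq]
    exact this.symm
  have hσ : σ = c * (c⁻¹ * σ) := by simp
  set τ := c⁻¹ * σ with hτ
  have hsub : (swap a (c a) * c).support ⊆ c.support := by
    intro x hx
    exact mem_support.2 (ne_and_ne_of_swap_mul_apply_ne_self (mem_support.1 hx)).1
  have hdis' : (swap a (c a) * c).Disjoint τ := by
    rw [disjoint_iff_disjoint_support] at hdis ⊢
    exact Finset.disjoint_of_subset_left hsub hdis
  rw [← hca]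
  conv_lhs => rw [hσ]
  conv_rhs => rw [hσ]
  rw [← mul_assoc (swap a (c a)), Disjoint.permColength_mul hdis, Disjoint.permColength_mul hdis']
  have hca' : c a ≠ a := by rwa [hca]
  suffices permColength c = permColength (swap a (c a) * c) + 1 by omega
  rw [permColength_isCycle hcyc]
  by_cases hcc : c (c a) = a
  · have h1 : c = swap a (c a) := hcyc.eq_swap_of_apply_apply_eq_self hca' hcc
    have h2 : swap a (c a) * c = 1 := by
      conv_lhs => rw [h1]
      simp
    rw [h2, permColength_one]
    rw [h1, card_support_swap (by simpa using hca'.symm)]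
  · rw [permColength_isCycle (hcyc.swap_mul hca' hcc), support_swap_mul_eq _ _ hcc]
    have hm : a ∈ c.support := mem_support.2 hca'
    have h2 := hcyc.two_le_card_support
    rw [← Finset.erase_eq, Finset.card_erase_of_mem hm]
    omega

lemma permColength_mul_swap {σ : Perm α} {a b : α} (ha : σ a = a) (hab : a ≠ b) :
    permColength (σ * swap a b) = permColength σ + 1 := by
  have h1 : (σ * swap a b) a = σ b := by simp
  have h2 : σ b ≠ a := fun h => hab (σ.injective (ha.trans h.symm))
  rw [permColength_swap_mul (a := a) (by rwa [h1]), h1]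
  congr 2
  have : swap a (σ b) * σ = σ * swap a b := by
    rw [mul_swap_eq_swap_mul, ha]
  rw [← mul_assoc, this, mul_assoc, swap_mul_self, mul_one]

end Colength

lemma card_fullCycleType_add {N : ℕ} (h : Perm (Fin N)) :
    N - (fullCycleType h).card = permColength h := by
  have h1 : h.cycleType.sum ≤ N := by
    simpa using (sum_cycleType h).le.trans (Finset.card_le_univ _)
  have h2 : permColength h + h.cycleType.card = h.cycleType.sum := by
    have : ∀ m : Multiset ℕ, (∀ x ∈ m, 1 ≤ x) → (m.map (· - 1)).sum + m.card = m.sum := by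
      intro m
      induction m using Multiset.induction with
      | empty => simp
      | cons a s ih =>
        intro hs
        have := ih fun x hx => hs x (Multiset.mem_cons_of_mem hx)
        have := hs a (Multiset.mem_cons_self a s)
        simp
        omega
    exact this _ fun x hx => (one_lt_of_mem_cycleType hx).le
  simp [fullCycleType]
  omega

end WHN

namespace WHN

open Equiv Equiv.Perm Polynomial

section Eigen

variable {α : Type*} [Fintype α] [DecidableEq α]

/-- The permutations supported in `A`. -/
def permsIn (A : Finset α) : Finset (Perm α) :=
  Finset.univ.filter fun h => ∀ x ∉ A, h x = x

lemma mem_permsIn {A : Finset α} {h : Perm α} : h ∈ permsIn A ↔ ∀ x ∉ A, h x = x := by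
  simp [permsIn]

/-- The generating polynomial of a function on permutations by colength, over the permutations
supported in `A`. -/
noncomputable def colengthSum (A : Finset α) (ψ : Perm α → ℚ) : ℚ[X] :=
  ∑ h ∈ permsIn A, X ^ permColength h * C (ψ h)

lemma colengthSum_empty (ψ : Perm α → ℚ) : colengthSum ∅ ψ = C (ψ 1) := by
  have : permsIn (∅ : Finset α) = {1} := by
    ext h
    simp [mem_permsIn, Equiv.ext_iff]
  simp [colengthSum, this, permColength_one]

/-- The factorisation of permutations behind the Jucys–Murphy elements. -/
lemma sum_permsIn_insert {M : Type*} [AddCommMonoid M] {A : Finset α} {a : α} (ha : a ∉ A)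
    (f : Perm α → M) :
    ∑ h ∈ permsIn (insert a A), f h =
      ∑ σ ∈ permsIn A, ∑ b ∈ insert a A, f (σ * swap a b) := by
  rw [← Finset.sum_product']
  refine Finset.sum_bij' (fun h _ => (h * swap a (h⁻¹ a), h⁻¹ a))
    (fun p _ => p.1 * swap a p.2) ?_ ?_ ?_ ?_ ?_
  · intro h hh
    rw [mem_permsIn] at hh
    simp only [Finset.mem_product, mem_permsIn]
    have hm : h⁻¹ a ∈ insert a A := by
      by_contra hn
      have h1 := hh _ hn
      rw [← mul_apply, mul_inv_cancel, one_apply] at h1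
      exact hn (h1 ▸ Finset.mem_insert_self a A)
    refine ⟨fun x hx => ?_, hm⟩
    by_cases hxa : x = a
    · subst hxa; simp
    · by_cases hxb : x = h⁻¹ a
      · rw [Finset.mem_insert] at hm
        rcases hm with hm | hm
        · exact absurd (hxb.trans hm) hxa
        · exact absurd (hxb ▸ hm) hx
      · rw [mul_apply, swap_apply_of_ne_of_ne hxa hxb]
        exact hh x (by simp [hxa, hx])
  · rintro ⟨σ, b⟩ hp
    simp only [Finset.mem_product, mem_permsIn] at hp ⊢
    obtain ⟨h1, h2⟩ := hp
    intro x hx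
    have hxa : x ≠ a := fun h => hx (h ▸ Finset.mem_insert_self a A)
    have hxb : x ≠ b := fun h => hx (h ▸ h2)
    rw [mul_apply, swap_apply_of_ne_of_ne hxa hxb]
    exact h1 x fun h => hx (Finset.mem_insert_of_mem h)
  · intro h _
    simp [mul_assoc]
  · rintro ⟨σ, b⟩ hp
    simp only [Finset.mem_product, mem_permsIn] at hp
    have h1 : σ⁻¹ a = a := by rw [inv_eq_iff_eq]; exact (hp.1 a ha).symm
    have h2 : (σ * swap a b)⁻¹ a = b := by
      rw [mul_inv_rev, mul_apply, h1, swap_inv, swap_apply_left]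
    simp only [h2, mul_assoc, swap_mul_self, mul_one]
  · intro h _
    simp [mul_assoc]

lemma colengthSum_insert {A : Finset α} {a : α} (ha : a ∉ A) {ψ : Perm α → ℚ} {c : ℚ}
    (hψ : ∀ σ, ∑ b ∈ A, ψ (σ * swap a b) = c * ψ σ) :
    colengthSum (insert a A) ψ = (1 + C c * X) * colengthSum A ψ := by
  rw [colengthSum, sum_permsIn_insert ha, colengthSum, Finset.mul_sum]
  refine Finset.sum_congr rfl fun σ hσ => ?_
  rw [mem_permsIn] at hσ
  rw [Finset.sum_insert ha]
  have : ∑ b ∈ A, X ^ permColength (σ * swap a b) * C (ψ (σ * swap a b))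
      = X ^ (permColength σ + 1) * C (∑ b ∈ A, ψ (σ * swap a b)) := by
    rw [map_sum, Finset.mul_sum]
    refine Finset.sum_congr rfl fun b hb => ?_
    rw [permColength_mul_swap (hσ a ha) (fun h => ha (h ▸ hb))]
  rw [this, hψ, C_mul, swap_self]
  change X ^ permColength (σ * 1) * C (ψ (σ * 1)) + _ = _
  rw [mul_one]
  ring

/-- A function on permutations which spans, under left translation, a copy of the hook
representation: antisymmetric on `B`, symmetric on its complement, with a Garnir relation. -/
structure IsHook (B : Finset α) (ψ : Perm α → ℚ) : Prop where
  anti : ∀ σ, ∀ a ∈ B, ∀ b ∈ B, a ≠ b → ψ (σ * swap a b) = -ψ σ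
  symm : ∀ σ, ∀ a ∉ B, ∀ b ∉ B, ψ (σ * swap a b) = ψ σ
  garnir : ∀ σ, ∀ a ∉ B, ∑ b ∈ B, ψ (σ * swap a b) = ψ σ

omit [Fintype α] in
lemma IsHook.translate {B : Finset α} {ψ : Perm α → ℚ} (h : IsHook B ψ) (g : Perm α) :
    IsHook B fun σ => ψ (g * σ) where
  anti σ a ha b hb hab := by simpa [mul_assoc] using h.anti (g * σ) a ha b hb hab
  symm σ a ha b hb := by simpa [mul_assoc] using h.symm (g * σ) a ha b hb
  garnir σ a ha := by simpa [mul_assoc] using h.garnir (g * σ) a ha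

/-- The content polynomial `∏ (1 + i X)` of a hook with leg length `b` and arm length `a`. -/
noncomputable def hookPoly (b a : ℕ) : ℚ[X] :=
  (∏ i ∈ Finset.range (b + 1), (1 + C (-(i : ℚ)) * X)) *
    ∏ i ∈ Finset.range a, (1 + C ((i : ℚ) + 1) * X)

lemma IsHook.colengthSum_subset {B : Finset α} {ψ : Perm α → ℚ} (h : IsHook B ψ)
    {A : Finset α} (hA : A ⊆ B) :
    colengthSum A ψ =
      (∏ i ∈ Finset.range A.card, (1 + C (-(i : ℚ)) * X)) * C (ψ 1) := by
  induction A using Finset.induction_on with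
  | empty => simp [colengthSum_empty]
  | insert a A ha ih =>
    rw [Finset.insert_subset_iff] at hA
    rw [colengthSum_insert ha (c := -(A.card : ℚ)), ih hA.2, Finset.card_insert_of_notMem ha,
      Finset.prod_range_succ]
    · ring
    · intro σ
      rw [Finset.sum_congr rfl fun b hb =>
        h.anti σ a hA.1 b (hA.2 hb) (fun e => ha (e ▸ hb))]
      simp

lemma IsHook.colengthSum_union {B : Finset α} {ψ : Perm α → ℚ} {k : ℕ} (h : IsHook B ψ)
    (hB : B.card = k + 1) {A : Finset α} (hA : Disjoint B A) :
    colengthSum (B ∪ A) ψ = hookPoly k A.card * C (ψ 1) := by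
  induction A using Finset.induction_on with
  | empty => simp [h.colengthSum_subset subset_rfl, hookPoly, hB]
  | insert a A ha ih =>
    rw [Finset.disjoint_insert_right] at hA
    have haB : a ∉ B ∪ A := by simp [hA.1, ha]
    rw [Finset.union_insert, colengthSum_insert haB (c := (A.card : ℚ) + 1), ih hA.2,
      Finset.card_insert_of_notMem ha, hookPoly, hookPoly, Finset.prod_range_succ _ A.card]
    · ring
    · intro σ
      rw [Finset.sum_union hA.2, h.garnir σ a hA.1, Finset.sum_congr rfl fun b hb =>
        h.symm σ a hA.1 b (Finset.disjoint_right.1 hA.2 hb)]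
      simp
      ring

lemma IsHook.sum_colength_eq {B : Finset α} {ψ : Perm α → ℚ} {k : ℕ} (h : IsHook B ψ)
    (hB : B.card = k + 1) (g : Perm α) (m : ℕ) :
    ∑ σ : Perm α with permColength σ = m, ψ (g * σ) =
      (hookPoly k Bᶜ.card).coeff m * ψ g := by
  have := congrArg (fun p => p.coeff m)
    ((h.translate g).colengthSum_union hB (A := Bᶜ) disjoint_compl_right)
  rw [Finset.union_compl] at this
  have h1 : permsIn (Finset.univ : Finset α) = Finset.univ := by ext; simp [mem_permsIn]
  simp only [colengthSum, h1, finsetSum_coeff, coeff_mul_C, coeff_X_pow, mul_one] at this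
  rw [← this, Finset.sum_filter]
  refine Finset.sum_congr rfl fun σ _ => ?_
  by_cases hm : permColength σ = m
  · simp [hm]
  · simp [hm, Ne.symm hm]

/-- Products of colength class sums act on hook functions by scalars. -/
lemma IsHook.sum_tuple_eq {B : Finset α} {ψ : Perm α → ℚ} {b : ℕ} (h : IsHook B ψ)
    (hB : B.card = b + 1) {k : ℕ} (ℓ : Fin k → ℕ) (g : Perm α) :
    ∑ σ : Fin k → Perm α with ∀ j, permColength (σ j) = ℓ j, ψ (g * (List.ofFn σ).prod) =
      (∏ j, (hookPoly b Bᶜ.card).coeff (ℓ j)) * ψ g := by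
  induction k generalizing g with
  | zero => simp
  | succ k ih =>
    rw [Finset.sum_filter, ← (Fin.consEquiv fun _ => Perm α).sum_comp, Fintype.sum_prod_type,
      Fin.prod_univ_succ]
    have key : ∀ σ : Perm α, (∑ τ : Fin k → Perm α,
        if ∀ j, permColength ((Fin.consEquiv fun _ => Perm α) (σ, τ) j) = ℓ j then
          ψ (g * (List.ofFn ((Fin.consEquiv fun _ => Perm α) (σ, τ))).prod) else 0) =
        if permColength σ = ℓ 0 then
          (∏ j : Fin k, (hookPoly b Bᶜ.card).coeff (ℓ j.succ)) * ψ (g * σ) else 0 := by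
      intro σ
      split_ifs with h0
      · rw [← ih (fun j => ℓ j.succ), Finset.sum_filter]
        refine Finset.sum_congr rfl fun τ _ => ?_
        simp [Fin.consEquiv, Fin.forall_fin_succ, h0, mul_assoc]
      · refine Finset.sum_eq_zero fun τ _ => ?_
        simp [Fin.consEquiv, Fin.forall_fin_succ, h0]
    rw [Finset.sum_congr rfl fun σ _ => key σ, ← Finset.sum_filter, ← Finset.mul_sum,
      h.sum_colength_eq hB]
    ring

end Eigen

end WHN

namespace WHN

open Equiv Equiv.Perm Matrix

section HookMatrix

variable {α : Type*} [Fintype α] [DecidableEq α]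

/-- The images under `g` of the standard basis, with the coordinate `o` replaced by `1`. -/
def markedPermMatrix (o : α) (g : Perm α) : Matrix α α ℚ :=
  Matrix.of fun c r => if r = o then 1 else if g c = r then 1 else 0

/-- The rows of `markedPermMatrix` in `B`, completed by rows of the identity. -/
def hookMatrix (o : α) (B : Finset α) (g : Perm α) : Matrix α α ℚ :=
  Matrix.of fun c => if c ∈ B then markedPermMatrix o g c else (1 : Matrix α α ℚ) c

omit [Fintype α] in
lemma markedPermMatrix_apply (o : α) (g : Perm α) (c r : α) :
    markedPermMatrix o g c r = if r = o then 1 else if g c = r then 1 else 0 := rfl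

omit [Fintype α] in
lemma hookMatrix_apply (o : α) (B : Finset α) (g : Perm α) (c r : α) :
    hookMatrix o B g c r =
      if c ∈ B then markedPermMatrix o g c r else (1 : Matrix α α ℚ) c r := by
  rw [hookMatrix, of_apply]
  split_ifs <;> rfl

lemma isHook_det_hookMatrix {o : α} {B : Finset α} (ho : o ∈ B) :
    IsHook B fun g => (hookMatrix o B g).det where
  anti σ a ha b hb hab := by
    have : hookMatrix o B (σ * swap a b) = (hookMatrix o B σ).submatrix (swap a b) id := by
      ext c r
      have hc : swap a b c ∈ B ↔ c ∈ B := by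
        rcases eq_or_ne c a with rfl | hca
        · simp [ha, hb]
        rcases eq_or_ne c b with rfl | hcb
        · simp [ha, hb]
        rw [swap_apply_of_ne_of_ne hca hcb]
      by_cases h : c ∈ B
      · simp [hookMatrix_apply, hc, h, markedPermMatrix_apply]
        congr
      · have hca : c ≠ a := fun e => h (e ▸ ha)
        have hcb : c ≠ b := fun e => h (e ▸ hb)
        simp [hookMatrix_apply, h, swap_apply_of_ne_of_ne hca hcb]
    rw [this, det_permute, sign_swap hab]
    simp
  symm σ a ha b hb := by
    congr 1
    ext c r
    by_cases h : c ∈ B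
    · have hca : c ≠ a := fun e => ha (e ▸ h)
      have hcb : c ≠ b := fun e => hb (e ▸ h)
      simp [hookMatrix_apply, h, markedPermMatrix_apply, swap_apply_of_ne_of_ne hca hcb]
    · simp [hookMatrix_apply, h]
  garnir σ a ha := by
    set M := hookMatrix o B σ with hM
    have h1 : ∀ b ∈ B, (hookMatrix o B (σ * swap a b)).det =
        cramer Mᵀ (markedPermMatrix o σ a) b := by
      intro b hb
      rw [cramer_transpose_apply]
      congr 1
      ext c r
      rcases eq_or_ne c b with rfl | hcb
      · simp [hookMatrix_apply, hb, markedPermMatrix_apply]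
      · rw [updateRow_ne hcb]
        by_cases h : c ∈ B
        · have hca : c ≠ a := fun e => ha (e ▸ h)
          simp [hM, hookMatrix_apply, h, markedPermMatrix_apply, swap_apply_of_ne_of_ne hca hcb]
        · simp [hM, hookMatrix_apply, h]
    rw [Finset.sum_congr rfl h1]
    have h2 := congrFun (mulVec_cramer Mᵀ (markedPermMatrix o σ a)) o
    rw [det_transpose, Pi.smul_apply, mulVec, dotProduct] at h2
    have h3 : markedPermMatrix o σ a o = 1 := by simp [markedPermMatrix_apply]
    rw [h3, smul_eq_mul, mul_one] at h2
    rw [← h2, ← Finset.sum_filter_add_sum_filter_not Finset.univ (· ∈ B)]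
    have h4 : ∀ c ∈ Finset.univ.filter (· ∉ B),
        Mᵀ o c * cramer Mᵀ (markedPermMatrix o σ a) c = 0 := by
      intro c hc
      have hc' : c ∉ B := by simpa using hc
      have : c ≠ o := fun e => hc' (e ▸ ho)
      simp [hM, hookMatrix_apply, hc', Matrix.one_apply_ne this]
    rw [Finset.sum_eq_zero h4, add_zero]
    simp only [Finset.filter_mem_eq_inter, Finset.univ_inter]
    refine Finset.sum_congr rfl fun b hb => ?_
    simp [hM, hookMatrix_apply, hb, markedPermMatrix_apply]

lemma det_hookMatrix_one {o : α} {B : Finset α} (ho : o ∈ B) :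
    (hookMatrix o B 1).det = 1 := by
  rw [← det_one (n := α) (R := ℚ)]
  refine det_eq_of_forall_row_eq_smul_add_const
    (fun c => if c ∈ B ∧ c ≠ o then 1 else 0) o (by simp) fun c r => ?_
  by_cases h : c ∈ B
  · rcases eq_or_ne c o with rfl | hco
    · rcases eq_or_ne r c with rfl | hr
      · simp [hookMatrix_apply, h, markedPermMatrix_apply]
      · simp [hookMatrix_apply, h, markedPermMatrix_apply, hr, Matrix.one_apply]
        congr
    · rcases eq_or_ne r o with rfl | hr
      · simp [hookMatrix_apply, h, markedPermMatrix_apply, hco]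
      · simp [hookMatrix_apply, h, markedPermMatrix_apply, hco, hr, hr.symm, Matrix.one_apply]
        congr
  · simp [hookMatrix_apply, h]

/-- The matrix of `1 - g` with the column `o` replaced by ones. -/
def markedLaplacian (o : α) (g : Perm α) : Matrix α α ℚ :=
  Matrix.of fun c r => if r = o then 1 else (if c = r then 1 else 0) - if g c = r then 1 else 0

omit [Fintype α] in
lemma markedLaplacian_apply (o : α) (g : Perm α) (c r : α) :
    markedLaplacian o g c r =
      if r = o then 1 else (if c = r then 1 else 0) - if g c = r then 1 else 0 := rfl

lemma sum_det_hookMatrix (o : α) (g : Perm α) :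
    ∑ S ∈ (Finset.univ.erase o).powerset, (-1) ^ S.card * (hookMatrix o (insert o S) g).det =
      (markedLaplacian o g).det := by
  let s : α → ℚ := fun c => if c = o then 1 else -1
  let m : Matrix α α ℚ := Matrix.of fun c r => s c * markedPermMatrix o g c r
  let m' : Matrix α α ℚ := Matrix.of fun c r => if c = o then 0 else (1 : Matrix α α ℚ) c r
  have h1 : (markedLaplacian o g).det = (m + m').det := by
    have : m + m' = Matrix.of fun c r => -s c *
        (Matrix.of fun c r => -s r * markedLaplacian o g c r : Matrix α α ℚ) c r := by
      ext c r
      rcases eq_or_ne c o with hc | hc <;> rcases eq_or_ne r o with hr | hr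
      · simp [m, m', s, markedPermMatrix_apply, markedLaplacian_apply, hc, hr]
      · simp [m, m', s, markedPermMatrix_apply, markedLaplacian_apply, hc, hr, hr.symm]
      · simp [m, m', s, markedPermMatrix_apply, markedLaplacian_apply, hc, hr]
      · simp only [m, m', s, Matrix.add_apply, of_apply, markedPermMatrix_apply,
          markedLaplacian_apply, hc, hr, if_false, Matrix.one_apply]
        ring
    rw [this, det_mul_column, det_mul_row, ← mul_assoc, ← Finset.prod_mul_distrib]
    have h : ∀ c, -s c * -s c = 1 := fun c => by simp only [s]; split_ifs <;> norm_num
    simp [h]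
  have h2 : (m + m').det =
      ∑ T : Finset α, (Matrix.of fun c r => if c ∈ T then m c r else m' c r).det := by
    refine ((detRowAlternating (n := α) (R := ℚ)).map_add_univ m m').trans
      (Finset.sum_congr rfl fun T _ => congrArg Matrix.det ?_)
    ext c r
    by_cases hc : c ∈ T <;> simp [Finset.piecewise, hc]
  rw [h1, h2]
  symm
  rw [← Finset.sum_filter_add_sum_filter_not Finset.univ (o ∈ ·),
    Finset.sum_eq_zero (s := Finset.univ.filter (o ∉ ·)), add_zero]
  · refine Finset.sum_bij' (fun T _ => T.erase o) (fun S _ => insert o S) ?_ ?_ ?_ ?_ ?_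
    · intro T hT
      simpa using Finset.erase_subset_erase o (Finset.subset_univ T)
    · intro S hS
      simp
    · intro T hT
      exact Finset.insert_erase (by simpa using hT)
    · intro S hS
      refine Finset.erase_insert fun h => ?_
      simpa using Finset.mem_powerset.1 hS h
    · intro T hT
      have hT : o ∈ T := by simpa using hT
      rw [Finset.insert_erase hT]
      have : (Matrix.of fun c r => if c ∈ T then m c r else m' c r) =
          Matrix.of fun c r => (if c ∈ T.erase o then -1 else 1) * hookMatrix o T g c r := by
        ext c r
        rw [of_apply, of_apply, hookMatrix_apply]
        by_cases hc : c ∈ T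
        · rw [if_pos hc, if_pos hc]
          by_cases hco : c = o
          · simp [hco, m, s]
          · simp [hc, hco, m, s]
        · have hco : c ≠ o := fun e => hc (e ▸ hT)
          rw [if_neg hc, if_neg hc]
          simp [hc, hco, m']
      rw [this, det_mul_column, Finset.prod_ite_mem]
      simp
  · intro T hT
    have hT : o ∉ T := by simpa using hT
    refine det_eq_zero_of_row_eq_zero o fun r => ?_
    rw [of_apply, if_neg hT]
    simp [m']

lemma det_markedLaplacian_of_not_sameCycle (o : α) {g : Perm α} {x y : α}
    (h : ¬ g.SameCycle x y) : (markedLaplacian o g).det = 0 := by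
  classical
  rw [← exists_vecMul_eq_zero_iff]
  let O := Finset.univ.filter (g.SameCycle x)
  have hx : x ∈ O := by simp [O, SameCycle.refl]
  have hy : y ∈ Oᶜ := by simp [O, h]
  have hinv : ∀ c, g c ∈ O ↔ c ∈ O := fun c => by simp [O]
  let v : α → ℚ := fun c => if c ∈ O then (Oᶜ.card : ℚ) else -(O.card : ℚ)
  refine ⟨v, fun hv => ?_, ?_⟩
  · have := congrFun hv x
    simp only [v, hx, if_true, Pi.zero_apply, Nat.cast_eq_zero, Finset.card_eq_zero] at this
    rw [this] at hy
    simp at hy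
  · ext r
    rw [vecMul, dotProduct]
    by_cases hr : r = o
    · simp only [markedLaplacian_apply, hr, if_true, mul_one, Pi.zero_apply, v]
      rw [Finset.sum_ite]
      have : Finset.univ.filter (· ∉ O) = Oᶜ := by ext; simp
      rw [this]
      simp only [Finset.filter_mem_eq_inter, Finset.univ_inter, Finset.sum_const, nsmul_eq_mul]
      ring
    · have hc : ∀ c, g c = r ↔ c = g.symm r := fun c => by rw [Equiv.eq_symm_apply]
      have : v (g.symm r) = v r := by
        have := hinv (g.symm r)
        rw [g.apply_symm_apply] at this
        simp only [v, this]
      simp [markedLaplacian_apply, hr, mul_sub, hc, this]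

lemma det_cyclicLaplacian (n : ℕ) :
    (Matrix.of fun i j : Fin (n + 1) => if j = 0 then (1 : ℚ) else
      (if i = j then 1 else 0) - if (i : ℕ) + 1 = j then 1 else 0).det = n + 1 := by
  set Z := (Matrix.of fun i j : Fin (n + 1) => if j = 0 then (1 : ℚ) else
      (if i = j then 1 else 0) - if (i : ℕ) + 1 = j then 1 else 0) with hZ
  let T : Matrix (Fin (n + 1)) (Fin (n + 1)) ℚ := Matrix.of fun i k => if i ≤ k then 1 else 0
  have hT : T.det = 1 := by
    rw [det_of_isUpperTriangular]
    · simp [T]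
    · intro i j hij
      simp only [T, of_apply]
      exact if_neg (not_le.2 hij)
  have hTZ : ∀ i j, j ≠ 0 → (T * Z) i j = if i = j then 1 else 0 := by
    intro i j hj
    have hj' : (j : ℕ) ≠ 0 := fun h => hj (Fin.ext h)
    have hlt := j.2
    let p : Fin (n + 1) := ⟨j - 1, by omega⟩
    have hk : ∀ k : Fin (n + 1), (k : ℕ) + 1 = j ↔ k = p := fun k => by
      simp only [Fin.ext_iff, p]; omega
    simp only [Matrix.mul_apply, T, hZ, of_apply, hj, if_false, hk, mul_sub, Finset.sum_sub_distrib,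
      mul_ite, mul_one, mul_zero, Finset.sum_ite_eq', Finset.mem_univ, if_true]
    have h1 : i ≤ p ↔ i < j := by simp only [Fin.le_def, Fin.lt_def, p]; omega
    simp only [h1]
    rcases lt_trichotomy i j with h | h | h
    · simp [h, h.le, h.ne]
    · simp [h]
    · simp [not_le.2 h, not_lt.2 h.le, h.ne']
  have hdet : (T * Z).det = n + 1 := by
    rw [det_of_isLowerTriangular, Fin.prod_univ_succ]
    · have : (T * Z) 0 0 = n + 1 := by simp [Matrix.mul_apply, T, hZ]
      rw [this, Finset.prod_eq_one fun i _ => ?_, mul_one]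
      rw [hTZ _ _ (Fin.succ_ne_zero i), if_pos rfl]
    · intro i j hij
      have hij : i < j := hij
      rw [hTZ _ _ (Fin.ne_zero_of_lt hij), if_neg hij.ne]
  rwa [det_mul, hT, one_mul] at hdet

lemma det_markedLaplacian_of_sameCycle {n : ℕ} {g : Perm (Fin (n + 1))}
    (h : ∀ x y, g.SameCycle x y) : (markedLaplacian 0 g).det = n + 1 := by
  have hon : g.IsCycleOn (Finset.univ : Finset (Fin (n + 1))) :=
    ⟨by simp [Set.bijOn_univ], fun x _ y _ => h x y⟩
  have hpow : ∀ i j : ℕ, (g ^ i) 0 = (g ^ j) 0 ↔ i ≡ j [MOD n + 1] := fun i j => by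
    simpa using hon.pow_apply_eq_pow_apply (Finset.mem_univ 0) (m := i) (n := j)
  have hinj : Function.Injective fun i : Fin (n + 1) => (g ^ (i : ℕ)) 0 := by
    intro i j hij
    have := (hpow i j).1 hij
    exact Fin.ext (Nat.ModEq.eq_of_lt_of_lt this i.2 j.2)
  let e : Fin (n + 1) ≃ Fin (n + 1) := Equiv.ofBijective _ (Finite.injective_iff_bijective.1 hinj)
  have he : ∀ i, e i = (g ^ (i : ℕ)) 0 := fun i => rfl
  rw [← det_submatrix_equiv_self e, ← det_cyclicLaplacian n]
  congr 1
  ext i j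
  have h0 : e j = 0 ↔ j = 0 := by
    rw [← e.injective.eq_iff (a := j), he 0]; simp
  have hs : g (e i) = e j ↔ ((i : ℕ) + 1) % (n + 1) = j := by
    rw [he, he, ← Perm.mul_apply, ← pow_succ', hpow, Nat.ModEq, Nat.mod_eq_of_lt j.2]
  simp only [markedLaplacian_apply, submatrix_apply, of_apply, h0, hs, e.injective.eq_iff]
  by_cases hj : j = 0
  · simp [hj]
  · have hj' : (j : ℕ) ≠ 0 := fun h => hj (Fin.ext h)
    have : ((i : ℕ) + 1) % (n + 1) = j ↔ (i : ℕ) + 1 = j := by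
      have := i.2
      have := j.2
      rcases Nat.lt_or_ge ((i : ℕ) + 1) (n + 1) with hi | hi
      · rw [Nat.mod_eq_of_lt hi]
      · have hi' : (i : ℕ) + 1 = n + 1 := by omega
        rw [hi', Nat.mod_self]
        omega
    simp only [this]

end HookMatrix

end WHN

namespace WHN

open Equiv Equiv.Perm

section Counting

lemma fullCycleType_eq_part1_iff {n : ℕ} {g : Perm (Fin (n + 1))} :
    fullCycleType g = (part1 (n + 1)).parts ↔ ∀ x y, g.SameCycle x y := by
  rw [part1, Nat.Partition.indiscrete_parts n.succ_ne_zero, fullCycleType]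
  rcases Nat.eq_zero_or_pos n with rfl | hn
  · have : Subsingleton (Fin (0 + 1)) := Fin.subsingleton_one
    have hg : g = 1 := Subsingleton.elim _ _
    have : ∀ x y, g.SameCycle x y := fun x y => Subsingleton.elim x y ▸ SameCycle.refl g x
    simp [hg]
  constructor
  · intro h
    have hmem : n + 1 ∈ g.cycleType + Multiset.replicate (n + 1 - g.cycleType.sum) 1 := by
      simp [h]
    have hmem : n + 1 ∈ g.cycleType := by
      refine (Multiset.mem_add.1 hmem).resolve_right fun h1 => ?_
      have := Multiset.eq_of_mem_replicate h1
      omega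
    have hle : g.cycleType ≤ {n + 1} := h ▸ Multiset.le_add_right _ _
    have heq : g.cycleType = {n + 1} :=
      le_antisymm hle (Multiset.singleton_le.2 hmem)
    have hcyc : g.IsCycle := card_cycleType_eq_one.1 (by simp [heq])
    have hsup : g.support = Finset.univ := by
      rw [← Finset.card_eq_iff_eq_univ, ← sum_cycleType, heq]
      simp
    have hne : ∀ x, g x ≠ x := fun x => mem_support.1 (by simp [hsup])
    exact fun x y => hcyc.sameCycle (hne x) (hne y)
  · intro h
    have : Nontrivial (Fin (n + 1)) := Fin.nontrivial_iff_two_le.2 (by omega)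
    have hne : ∀ x, g x ≠ x := fun x hx => by
      obtain ⟨y, hy⟩ := exists_ne x
      exact hy ((h x y).eq_of_left hx).symm
    have hcyc : g.IsCycle := ⟨0, hne 0, fun y _ => h 0 y⟩
    have hsup : g.support = Finset.univ := by
      ext x
      simp [hne x]
    simp [hcyc.cycleType, hsup]

lemma fullCycleType_inv {N : ℕ} (g : Perm (Fin N)) : fullCycleType g⁻¹ = fullCycleType g := by
  simp only [fullCycleType, cycleType_inv]

/-- The cycle type of a permutation as a partition. -/
def cyclePartition {N : ℕ} (g : Perm (Fin N)) : N.Partition where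
  parts := fullCycleType g
  parts_pos {i} hi := by
    rcases Multiset.mem_add.1 hi with h | h
    · exact zero_lt_one.trans (one_lt_of_mem_cycleType h)
    · simp [Multiset.eq_of_mem_replicate h]
  parts_sum := by
    have := sum_cycleType_le g
    rw [Fintype.card_fin] at this
    simp only [fullCycleType, Multiset.sum_add, Multiset.sum_replicate, smul_eq_mul, mul_one]
    omega

lemma connHurwitz_eq_pureHurwitz {n k : ℕ} {μ : Fin k → (n + 1).Partition} {i : Fin k}
    (hi : μ i = part1 (n + 1)) : connHurwitz μ = pureHurwitz μ := by
  rw [connHurwitz, pureHurwitz]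
  congr 2
  refine Nat.card_congr (Equiv.subtypeEquivRight fun h => ?_)
  refine ⟨fun H => ⟨H.1, H.2.1⟩, fun H => ⟨H.1, H.2, fun x y => ?_⟩⟩
  have hcyc := H.1 i
  rw [hi, fullCycleType_eq_part1_iff] at hcyc
  obtain ⟨m, hm⟩ := hcyc x y
  exact ⟨h i ^ m, Subgroup.zpow_mem _ (Subgroup.subset_closure (Set.mem_range_self i)) m, hm⟩

lemma Fconn_part1 {n k : ℕ} (ℓ : Fin k → ℕ) :
    Fconn (n + 1) (part1 (n + 1)) ℓ = Fsum (n + 1) (part1 (n + 1)) ℓ :=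
  Finset.sum_congr rfl fun _ _ => connHurwitz_eq_pureHurwitz (i := Fin.last k) (by simp)

lemma pureHurwitz_snoc_part1 {n k : ℕ} (ν : Fin k → (n + 1).Partition) :
    pureHurwitz (Fin.snoc ν (part1 (n + 1)) : Fin (k + 1) → (n + 1).Partition) =
      (Nat.card {σ : Fin k → Perm (Fin (n + 1)) // (∀ j, fullCycleType (σ j) = (ν j).parts) ∧
        ∀ x y, (List.ofFn σ).prod.SameCycle x y} : ℚ) / (n + 1).factorial := by
  rw [pureHurwitz]
  congr 2
  have key : ∀ h : Fin (k + 1) → Perm (Fin (n + 1)), (List.ofFn h).prod =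
      (List.ofFn fun i : Fin k => h i.castSucc).prod * h (Fin.last k) := fun h => by
    rw [List.ofFn_succ_last, List.prod_append, List.prod_singleton]
  apply Nat.card_congr
  refine
    { toFun := fun h => ⟨fun i => h.1 i.castSucc, fun j => ?_, ?_⟩
      invFun := fun σ => ⟨Fin.snoc σ.1 (List.ofFn σ.1).prod⁻¹, fun j => ?_, ?_⟩
      left_inv := fun h => ?_
      right_inv := fun σ => ?_ }
  · simpa using h.2.1 j.castSucc
  · have h1 := h.2.1 (Fin.last k)
    have h2 := h.2.2
    rw [key, mul_eq_one_iff_eq_inv] at h2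
    rw [Fin.snoc_last] at h1
    rw [h2, ← fullCycleType_eq_part1_iff, fullCycleType_inv, h1]
  · refine Fin.lastCases ?_ (fun i => ?_) j
    · simpa [fullCycleType_inv, fullCycleType_eq_part1_iff] using σ.2.2
    · simpa using σ.2.1 i
  · rw [key]
    simp
  · have h2 := h.2.2
    rw [key, mul_eq_one_iff_inv_eq] at h2
    apply Subtype.ext
    dsimp only
    rw [h2]
    exact Fin.snoc_init_self h.1
  · apply Subtype.ext
    simp

lemma Fsum_part1 {n k : ℕ} (ℓ : Fin k → ℕ) :
    Fsum (n + 1) (part1 (n + 1)) ℓ =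
      (Nat.card {σ : Fin k → Perm (Fin (n + 1)) // (∀ j, permColength (σ j) = ℓ j) ∧
        ∀ x y, (List.ofFn σ).prod.SameCycle x y} : ℚ) / (n + 1).factorial := by
  classical
  rw [Fsum, Finset.sum_congr rfl fun ν _ => pureHurwitz_snoc_part1 ν, ← Finset.sum_div]
  congr 1
  simp only [Nat.card_eq_fintype_card, Fintype.card_subtype]
  rw [← Nat.cast_sum, Nat.cast_inj]
  symm
  rw [Finset.card_eq_sum_card_fiberwise (f := fun σ j => cyclePartition (σ j))
    (t := Finset.univ.filter fun ν : Fin k → (n + 1).Partition => ∀ j, colength (ν j) = ℓ j)]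
  · refine Finset.sum_congr rfl fun ν hν => congrArg Finset.card ?_
    have hν : ∀ j, colength (ν j) = ℓ j := by simpa using hν
    ext σ
    simp only [Finset.mem_filter, Finset.mem_univ, true_and, funext_iff, Nat.Partition.ext_iff]
    constructor
    · rintro ⟨⟨-, h2⟩, h3⟩
      exact ⟨h3, h2⟩
    · rintro ⟨h1, h2⟩
      refine ⟨⟨fun j => ?_, h2⟩, h1⟩
      rw [← hν, colength, ← h1, card_fullCycleType_add]
  · intro σ hσ
    simp only [Finset.coe_filter, Finset.mem_univ, true_and, Set.mem_ofPred_eq] at hσ ⊢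
    intro j
    rw [← hσ.1 j, ← card_fullCycleType_add]
    rfl

/-- The expansion of the one-part sums of pure Hurwitz numbers over hook shapes. -/
lemma Fsum_part1_eq_sum_hookPoly {n k : ℕ} (ℓ : Fin k → ℕ) :
    Fsum (n + 1) (part1 (n + 1)) ℓ =
      (∑ b ∈ Finset.range (n + 1), (-1) ^ b * (n.choose b : ℚ) *
        ∏ j, (hookPoly b (n - b)).coeff (ℓ j)) / ((n + 1) * (n + 1).factorial) := by
  classical
  rw [Fsum_part1, ← div_div]
  congr 1
  rw [eq_div_iff (by positivity), Nat.card_eq_fintype_card, Fintype.card_subtype,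
    ← Finset.filter_filter, Finset.card_filter, Nat.cast_sum, Finset.sum_mul]
  have h1 : ∀ g : Perm (Fin (n + 1)), ((if ∀ x y, g.SameCycle x y then 1 else 0 : ℕ) : ℚ) *
      (n + 1) = ∑ S ∈ (Finset.univ.erase (0 : Fin (n + 1))).powerset,
        (-1) ^ S.card * (hookMatrix 0 (insert 0 S) (1 * g)).det := fun g => by
    rw [one_mul, sum_det_hookMatrix]
    split_ifs with h
    · rw [det_markedLaplacian_of_sameCycle h, Nat.cast_one, one_mul]
    · push Not at h
      obtain ⟨x, y, h⟩ := h
      rw [det_markedLaplacian_of_not_sameCycle 0 h, Nat.cast_zero, zero_mul]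
  rw [Finset.sum_congr rfl fun σ _ => h1 _, Finset.sum_comm]
  have h2 : ∀ S ∈ (Finset.univ.erase (0 : Fin (n + 1))).powerset,
      (∑ σ : Fin k → Perm (Fin (n + 1)) with ∀ j, permColength (σ j) = ℓ j,
        (-1) ^ S.card * (hookMatrix 0 (insert 0 S) (1 * (List.ofFn σ).prod)).det) =
      (-1) ^ S.card * ∏ j, (hookPoly S.card (n - S.card)).coeff (ℓ j) := fun S hS => by
    have h0 : (0 : Fin (n + 1)) ∉ S := fun h => by
      simpa using Finset.mem_powerset.1 hS h
    have hcard : (insert (0 : Fin (n + 1)) S).card = S.card + 1 := Finset.card_insert_of_notMem h0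
    have hc : (insert (0 : Fin (n + 1)) S)ᶜ.card = n - S.card := by
      rw [Finset.card_compl, hcard, Fintype.card_fin]
      omega
    have ho := Finset.mem_insert_self (0 : Fin (n + 1)) S
    rw [← Finset.mul_sum, (isHook_det_hookMatrix ho).sum_tuple_eq hcard, hc,
      det_hookMatrix_one ho, mul_one]
  rw [Finset.sum_congr rfl h2, Finset.sum_powerset_apply_card
    (fun b => (-1) ^ b * ∏ j, (hookPoly b (n - b)).coeff (ℓ j)),
    Finset.card_erase_of_mem (Finset.mem_univ _), Finset.card_univ, Fintype.card_fin]
  refine Finset.sum_congr rfl fun b _ => ?_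
  rw [nsmul_eq_mul, Nat.add_sub_cancel]
  ring

end Counting

end WHN

namespace WHN

open Polynomial

section Monomial

variable {R : Type*} [CommRing R] [Algebra ℚ R] {L : ℕ}

omit [Algebra ℚ R] in
lemma coeff_prod_eq_sum_sym (f : Fin L → R[X]) (d : ℕ) :
    (∏ i, f i).coeff d =
      ∑ s : Sym (Fin L) d, ∏ i, (f i).coeff ((s : Multiset (Fin L)).count i) := by
  have h : (∏ i, f i).coeff d = PowerSeries.coeff d (∏ i, (f i : PowerSeries R)) := by
    rw [← Polynomial.coeff_coe, ← Polynomial.coeToPowerSeries.ringHom_apply, map_prod]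
    rfl
  rw [h, PowerSeries.coeff_prod]
  symm
  refine Finset.sum_bij (fun s _ => Multiset.toFinsupp (s : Multiset (Fin L))) ?_ ?_ ?_ ?_
  · intro s _
    simp only [Finset.mem_finsuppAntidiag, Finset.subset_univ, and_true]
    change ∑ i, (s : Multiset (Fin L)).count i = d
    rw [Multiset.sum_count_eq_card fun _ _ => Finset.mem_univ _]
    exact s.2
  · intro s _ t _ hst
    exact Subtype.ext (Multiset.toFinsupp.injective hst)
  · intro l hl
    have hl : ∑ i, l i = d := by simpa using hl
    refine ⟨⟨Finsupp.toMultiset l, ?_⟩, Finset.mem_univ _, ?_⟩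
    · rw [Finsupp.card_toMultiset, Finsupp.sum_fintype _ _ fun _ => rfl]
      exact hl
    · simp
  · intro s _
    simp

lemma sum_msymmEval_mul (c : Fin L → R) (d : ℕ) {p : ℚ[X]} (hp : p.coeff 0 = 1) :
    ∑ lam : d.Partition, msymmEval c lam *
        algebraMap ℚ R (∏ j, p.coeff ((sortedParts lam).get j)) =
      (∏ j, (p.map (algebraMap ℚ R)).comp (C (c j) * X)).coeff d := by
  have h1 : ∀ lam : d.Partition, msymmEval c lam *
      algebraMap ℚ R (∏ j, p.coeff ((sortedParts lam).get j)) =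
      ∑ s : {s : Sym (Fin L) d // Nat.Partition.ofSym s = lam},
        ∏ i, algebraMap ℚ R (p.coeff ((s.1 : Multiset (Fin L)).count i)) *
          c i ^ (s.1 : Multiset (Fin L)).count i := by
    intro lam
    have h2 : ∏ j, p.coeff ((sortedParts lam).get j) = (lam.parts.map p.coeff).prod := by
      conv_rhs => rw [← Multiset.sort_eq lam.parts (· ≥ ·), Multiset.map_coe, Multiset.prod_coe]
      exact Fin.prod_univ_fun_getElem (sortedParts lam) p.coeff
    rw [h2, msymmEval, MvPolynomial.msymm, map_sum, Finset.sum_mul]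
    refine Finset.sum_congr rfl fun s _ => ?_
    obtain ⟨s, rfl⟩ := s
    have h3 : ((Nat.Partition.ofSym s).parts.map p.coeff).prod =
        ∏ i, p.coeff ((s : Multiset (Fin L)).count i) := by
      rw [Nat.Partition.ofSym, Multiset.map_map]
      change ∏ i ∈ (s : Multiset (Fin L)).toFinset, p.coeff ((s : Multiset (Fin L)).count i) = _
      refine Finset.prod_subset (Finset.subset_univ _) fun i _ hi => ?_
      rw [Multiset.count_eq_zero_of_notMem (by simpa using hi), hp]
    have h4 : MvPolynomial.eval c ((s : Multiset (Fin L)).map MvPolynomial.X).prod =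
        ∏ i, c i ^ (s : Multiset (Fin L)).count i := by
      rw [map_multiset_prod, Multiset.map_map]
      simp only [Function.comp_def, MvPolynomial.eval_X]
      rw [Finset.prod_multiset_map_count]
      refine Finset.prod_subset (Finset.subset_univ _) fun i _ hi => ?_
      rw [Multiset.count_eq_zero_of_notMem (by simpa using hi), pow_zero]
    rw [h3, map_prod, Finset.prod_mul_distrib, mul_comm]
    exact congrArg _ h4
  rw [Finset.sum_congr rfl fun lam _ => h1 lam, coeff_prod_eq_sum_sym]
  simp only [comp_C_mul_X_coeff, coeff_map]
  exact Fintype.sum_fiberwise (fun s : Sym (Fin L) d => Nat.Partition.ofSym s)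
    fun s => ∏ i, algebraMap ℚ R (p.coeff ((s : Multiset (Fin L)).count i)) *
      c i ^ (s : Multiset (Fin L)).count i

lemma prod_Icc_neg_natCast {M : Type*} [CommMonoid M] (f : ℤ → M) (b a : ℕ) :
    ∏ i ∈ Finset.Icc (-(b : ℤ)) a, f i =
      (∏ i ∈ Finset.range (b + 1), f (-(i : ℤ))) * ∏ i ∈ Finset.range a, f ((i : ℤ) + 1) := by
  induction a with
  | zero =>
    rw [Finset.prod_range_zero, mul_one]
    refine Finset.prod_bij' (fun i _ => i.natAbs) (fun i _ => -(i : ℤ)) ?_ ?_ ?_ ?_ ?_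
    all_goals
      intro i hi
      simp only [Finset.mem_Icc, Finset.mem_range] at *
    any_goals omega
    congr 1
    omega
  | succ a ih =>
    have : Finset.Icc (-(b : ℤ)) ((a + 1 : ℕ) : ℤ) =
        insert ((a : ℤ) + 1) (Finset.Icc (-(b : ℤ)) a) := by
      ext i
      simp only [Finset.mem_Icc, Finset.mem_insert]
      omega
    rw [this, Finset.prod_insert (by simp), ih, Finset.prod_range_succ _ a]
    exact (mul_comm _ _).trans (mul_assoc _ _ _)

lemma prod_comp_hookPoly (c : Fin L → R) (b a : ℕ) :
    ∏ j, ((hookPoly b a).map (algebraMap ℚ R)).comp (C (c j) * X) =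
      ∏ i ∈ Finset.Icc (-(b : ℤ)) (a : ℤ), ∏ j, (1 + C ((i : R) * c j) * X) := by
  rw [Finset.prod_comm]
  refine Finset.prod_congr rfl fun j _ => ?_
  rw [prod_Icc_neg_natCast, hookPoly, Polynomial.map_mul, mul_comp, Polynomial.map_prod,
    Polynomial.map_prod, prod_comp, prod_comp]
  congr 1 <;> refine Finset.prod_congr rfl fun i _ => ?_ <;> simp [mul_assoc]

lemma coeff_zero_hookPoly (b a : ℕ) : (hookPoly b a).coeff 0 = 1 := by
  simp [hookPoly, coeff_zero_eq_eval_zero, eval_prod]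

lemma weightedH_part1 (c : Fin L → R) (n d : ℕ) :
    weightedH c d (part1 (n + 1)) = algebraMap ℚ R (((n + 1 : ℕ) : ℚ)⁻¹) *
      ∑ a ∈ Finset.range (n + 1), rhoCoeff c a (n + 1 - a - 1) d := by
  have h1 : ∀ b ∈ Finset.range (n + 1), rhoCoeff c (n + 1 - 1 - b) (n + 1 - (n + 1 - 1 - b) - 1) d =
      algebraMap ℚ R ((-1) ^ b * (n.choose b : ℚ) / (n + 1).factorial) *
        ∑ lam : d.Partition, msymmEval c lam *
          algebraMap ℚ R (∏ j, (hookPoly b (n - b)).coeff ((sortedParts lam).get j)) := by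
    intro b hb
    have hb : b ≤ n := Nat.lt_succ_iff.1 (Finset.mem_range.1 hb)
    have e1 : n + 1 - 1 - b = n - b := by omega
    have e2 : n + 1 - (n - b) - 1 = b := by omega
    rw [e1, e2, rhoCoeff, sum_msymmEval_mul c d (coeff_zero_hookPoly _ _), prod_comp_hookPoly]
    congr 2
    have hn : n - b + b + 1 = n + 1 := by omega
    rw [hn, mul_div_assoc, Nat.factorial_succ, ← Nat.choose_mul_factorial_mul_factorial hb]
    have := (Nat.choose_pos hb).ne'
    push_cast
    field_simp
  rw [← Finset.sum_range_reflect, Finset.sum_congr rfl h1, weightedH]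
  simp only [Finset.mul_sum, Fsum_part1_eq_sum_hookPoly]
  rw [Finset.sum_comm]
  refine Finset.sum_congr rfl fun lam _ => ?_
  rw [Finset.sum_div, map_sum, Finset.mul_sum]
  refine Finset.sum_congr rfl fun b _ => ?_
  rw [mul_left_comm _ (msymmEval c lam), mul_left_comm _ (msymmEval c lam), ← map_mul, ← map_mul]
  congr 2
  push_cast
  field_simp

lemma weightedHconn_part1 (c : Fin L → R) (n d : ℕ) :
    weightedHconn c d (part1 (n + 1)) = weightedH c d (part1 (n + 1)) := by
  simp only [weightedHconn, weightedH, Fconn_part1]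

end Monomial

end WHN

open WHN in
/-- For the one-part partition `μ = (μ₁)` of `N = μ₁`, the connected and nonconnected
weighted Hurwitz numbers coincide and
`H̃^d_G((μ₁)) = H^d_G((μ₁)) = (1/μ₁) Σ_{a=0}^{μ₁−1} ρ^d_{a, μ₁−a−1}`. -/
theorem statement0 {R : Type*} [CommRing R] [Algebra ℚ R] {L : ℕ} (hL : 1 ≤ L)
    (c : Fin L → R) (μ1 : ℕ) (hμ1 : 1 ≤ μ1) (d : ℕ) :
    weightedHconn c d (part1 μ1) = weightedH c d (part1 μ1) ∧
    weightedH c d (part1 μ1) =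
      algebraMap ℚ R ((μ1 : ℚ)⁻¹) *
        ∑ a ∈ Finset.range μ1, rhoCoeff c a (μ1 - a - 1) d := by
  obtain ⟨n, rfl⟩ : ∃ n, μ1 = n + 1 := ⟨μ1 - 1, by omega⟩
  exact ⟨weightedHconn_part1 c n d, weightedH_part1 c n d⟩
end

section
/- For every partition μ of N and every integer d ≥ 1, the weighted Hurwitz number defined by the double sum over weighted ramification profiles equals the sum over partitions of d of monomial symmetric polynomials times sums of pure Hurwitz numbers with prescribed colengths: Σ_{k=1}^{d} Σ' 𝒲_G(μ⁽¹⁾,…,μ⁽ᵏ⁾) H(μ⁽¹⁾,…,μ⁽ᵏ⁾, μ) = Σ_{λ ⊢ d} m_λ(c₁,…,c_L) F_λ(μ), where Σ' runs over all k-tuples (μ⁽¹⁾,…,μ⁽ᵏ⁾) of partitions of N, each different from (1^N), with Σ_{i=1}^{k} ℓ*(μ⁽ⁱ⁾) = d. The same identity holds with H replaced by the connected pure Hurwitz number H̃ and F_λ by F̃_λ. -/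
open scoped BigOperators

namespace WHN

/-- The weight factor
`𝒲_G(μ⁽¹⁾,…,μ⁽ᵏ⁾) = (1/k!) Σ_{σ ∈ S_k} Σ_{1 ≤ b₁ < ⋯ < b_k ≤ L} ∏_i c_{b_{σ(i)}}^{ℓ*(μ⁽ⁱ⁾)}`. -/
noncomputable def weightFactor {R : Type*} [CommRing R] [Algebra ℚ R] {L : ℕ}
    (c : Fin L → R) {N k : ℕ} (ν : Fin k → N.Partition) : R :=
  algebraMap ℚ R ((k.factorial : ℚ)⁻¹) *
    ∑ σ : Equiv.Perm (Fin k),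
      ∑ b ∈ Finset.univ.filter (fun b : Fin k → Fin L => ∀ i j : Fin k, i < j → b i < b j),
        ∏ i, c (b (σ i)) ^ colength (ν i)

end WHN

namespace WHN

/-- Braid moves: if `T` and `T'` differ by a permutation, then the words whose letters have types
`T` inject into those with letters of types `T'`, preserving the product and the subgroup
generated by the letters. -/
theorem exists_braid {G ι : Type*} [Group G] (P : G → ι → Prop)
    (hP : ∀ x y i, P y i → P (x * y * x⁻¹) i) {T T' : List ι} (h : T.Perm T') :
    ∃ f : List G → List G, ∀ l, List.Forall₂ P l T → List.Forall₂ P (f l) T' ∧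
      (f l).prod = l.prod ∧
      Subgroup.closure {x | x ∈ f l} = Subgroup.closure {x | x ∈ l} ∧
      ∀ l', List.Forall₂ P l' T → f l = f l' → l = l' := by
  induction h with
  | nil => exact ⟨id, fun l hl => ⟨hl, rfl, rfl, fun _ _ h => h⟩⟩
  | cons a _ ih =>
    obtain ⟨f, hf⟩ := ih
    refine ⟨fun l => match l with | [] => [] | x :: l => x :: f l, ?_⟩
    rintro _ (_ | ⟨hx, hl⟩)
    rename_i x l
    obtain ⟨h1, h2, h3, h4⟩ := hf _ hl
    refine ⟨.cons hx h1, by simp [h2], ?_, ?_⟩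
    · have hins : ∀ m : List G, {y | y ∈ x :: m} = {x} ∪ {y | y ∈ m} := fun m => by ext; simp
      simp only [hins, Subgroup.closure_union, h3]
    · rintro _ (_ | ⟨hx', hl'⟩) he
      simp only [List.cons.injEq] at he ⊢
      exact ⟨he.1, h4 _ hl' he.2⟩
  | swap a b T =>
    refine ⟨fun l => match l with | x :: y :: l => (x * y * x⁻¹) :: x :: l | l => l, ?_⟩
    rintro _ (_ | ⟨hx, _ | ⟨hy, hl⟩⟩)
    rename_i x y l
    refine ⟨.cons (hP _ _ _ hy) (.cons hx hl), by simp [mul_assoc], ?_, ?_⟩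
    · apply le_antisymm <;> rw [Subgroup.closure_le] <;> intro z hz
      · have hmem : ∀ w ∈ x :: y :: l, w ∈ Subgroup.closure {w | w ∈ x :: y :: l} :=
          fun w hw => Subgroup.subset_closure hw
        simp only [Set.mem_ofPred_eq, List.mem_cons] at hz
        rcases hz with rfl | rfl | hz
        · exact mul_mem (mul_mem (hmem _ (by simp)) (hmem _ (by simp)))
            (inv_mem (hmem _ (by simp)))
        · exact hmem _ (by simp)
        · exact hmem _ (by simp [hz])
      · have hmem : ∀ w ∈ (x * y * x⁻¹) :: x :: l,
            w ∈ Subgroup.closure {w | w ∈ (x * y * x⁻¹) :: x :: l} :=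
          fun w hw => Subgroup.subset_closure hw
        simp only [Set.mem_ofPred_eq, List.mem_cons] at hz
        rcases hz with rfl | rfl | hz
        · exact hmem _ (by simp)
        · have := mul_mem (mul_mem (inv_mem (hmem x (by simp))) (hmem (x * z * x⁻¹) (by simp)))
            (hmem x (by simp))
          simpa [mul_assoc] using this
        · exact hmem _ (by simp [hz])
    · rintro _ (_ | ⟨hx', _ | ⟨hy', hl'⟩⟩) he
      simp only [List.cons.injEq] at he ⊢
      obtain ⟨h1, rfl, h3⟩ := he
      simpa [h3] using h1
  | trans _ _ ih1 ih2 =>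
    obtain ⟨f, hf⟩ := ih1
    obtain ⟨g, hg⟩ := ih2
    refine ⟨g ∘ f, fun l hl => ?_⟩
    obtain ⟨h1, h2, h3, h4⟩ := hf l hl
    obtain ⟨k1, k2, k3, k4⟩ := hg _ h1
    exact ⟨k1, k2.trans h2, k3.trans h3, fun l' hl' he => h4 l' hl' (k4 _ (hf l' hl').1 he)⟩

/-- Permuting the prescribed types does not decrease the number of factorizations of `1`. -/
theorem card_tuples_le {G ι : Type*} [Group G] [Finite G] (P : G → ι → Prop)
    (hP : ∀ x y i, P y i → P (x * y * x⁻¹) i) (Q : Subgroup G → Prop) {n : ℕ}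
    {T T' : Fin n → ι} (h : (List.ofFn T).Perm (List.ofFn T')) :
    Nat.card {g : Fin n → G // (∀ i, P (g i) (T i)) ∧ (List.ofFn g).prod = 1 ∧
      Q (Subgroup.closure (Set.range g))} ≤
    Nat.card {g : Fin n → G // (∀ i, P (g i) (T' i)) ∧ (List.ofFn g).prod = 1 ∧
      Q (Subgroup.closure (Set.range g))} := by
  obtain ⟨f, hf⟩ := exists_braid P hP h
  have hforall : ∀ (g : Fin n → G) (S : Fin n → ι),
      List.Forall₂ P (List.ofFn g) (List.ofFn S) ↔ ∀ i, P (g i) (S i) := by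
    intro g S
    rw [List.forall₂_iff_get]
    simp only [List.length_ofFn, List.get_ofFn, true_and]
    exact ⟨fun H i => by simpa using H i i.2 i.2, fun H i _ _ => H _⟩
  have hrange : ∀ g : Fin n → G, {x | x ∈ List.ofFn g} = Set.range g := fun g => by
    ext; simp [List.mem_ofFn]
  have hex : ∀ g : Fin n → G, (∀ i, P (g i) (T i)) →
      ∃ g' : Fin n → G, List.ofFn g' = f (List.ofFn g) := by
    intro g hg
    have hlen := (hf _ ((hforall g T).2 hg)).1.length_eq
    rw [List.length_ofFn] at hlen
    refine ⟨fun i => (f (List.ofFn g)).get (i.cast hlen.symm), ?_⟩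
    apply List.ext_get <;> simp [hlen]
  choose F hF using hex
  refine Nat.card_le_card_of_injective (fun g => ⟨F g.1 g.2.1, ?_⟩) ?_
  · obtain ⟨h1, h2, h3, -⟩ := hf _ ((hforall g.1 T).2 g.2.1)
    refine ⟨(hforall _ _).1 (by rw [hF]; exact h1), by rw [hF, h2]; exact g.2.2.1, ?_⟩
    rw [← hrange, hF, h3, hrange]
    exact g.2.2.2
  · intro g g' he
    have he' : F g.1 g.2.1 = F g'.1 g'.2.1 := congrArg Subtype.val he
    have := (hf _ ((hforall g.1 T).2 g.2.1)).2.2.2 _ ((hforall g'.1 T).2 g'.2.1)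
      (by rw [← hF _ g.2.1, ← hF _ g'.2.1, he'])
    exact Subtype.ext (List.ofFn_injective this)

theorem card_tuples_comp_snoc {N k : ℕ} (Q : Subgroup (Equiv.Perm (Fin N)) → Prop)
    (μ : N.Partition) (ν : Fin k → N.Partition) (σ : Equiv.Perm (Fin k)) :
    Nat.card {g : Fin (k + 1) → Equiv.Perm (Fin N) //
      (∀ i, fullCycleType (g i) = (Fin.snoc (α := fun _ => N.Partition) (ν ∘ σ) μ i).parts) ∧
      (List.ofFn g).prod = 1 ∧ Q (Subgroup.closure (Set.range g))} =
    Nat.card {g : Fin (k + 1) → Equiv.Perm (Fin N) //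
      (∀ i, fullCycleType (g i) = (Fin.snoc (α := fun _ => N.Partition) ν μ i).parts) ∧
      (List.ofFn g).prod = 1 ∧ Q (Subgroup.closure (Set.range g))} := by
  have hP : ∀ (x y : Equiv.Perm (Fin N)) (i : N.Partition), fullCycleType y = i.parts →
      fullCycleType (x * y * x⁻¹) = i.parts := by
    intro x y i h
    simpa only [fullCycleType, Equiv.Perm.cycleType_conj] using h
  have hperm : (List.ofFn (Fin.snoc (α := fun _ => N.Partition) (ν ∘ σ) μ)).Perm
      (List.ofFn (Fin.snoc (α := fun _ => N.Partition) ν μ)) := by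
    simp only [List.ofFn_succ', Fin.snoc_castSucc, Fin.snoc_last, List.concat_eq_append]
    exact (Equiv.Perm.ofFn_comp_perm σ ν).append_right _
  exact le_antisymm
    (card_tuples_le (fun g (i : N.Partition) => fullCycleType g = i.parts) hP Q hperm)
    (card_tuples_le (fun g (i : N.Partition) => fullCycleType g = i.parts) hP Q hperm.symm)

theorem pureHurwitz_snoc_comp_perm {N k : ℕ} (μ : N.Partition) (ν : Fin k → N.Partition)
    (σ : Equiv.Perm (Fin k)) :
    pureHurwitz (Fin.snoc (ν ∘ σ) μ) = pureHurwitz (Fin.snoc ν μ) := by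
  have := card_tuples_comp_snoc (fun _ => True) μ ν σ
  simp only [and_true] at this
  rw [pureHurwitz, pureHurwitz, this]

theorem connHurwitz_snoc_comp_perm {N k : ℕ} (μ : N.Partition) (ν : Fin k → N.Partition)
    (σ : Equiv.Perm (Fin k)) :
    connHurwitz (Fin.snoc (ν ∘ σ) μ) = connHurwitz (Fin.snoc ν μ) := by
  rw [connHurwitz, connHurwitz,
    card_tuples_comp_snoc (fun K => ∀ x y : Fin N, ∃ g ∈ K, g x = y) μ ν σ]

theorem colength_eq_zero_iff {N : ℕ} (ν : N.Partition) :
    colength ν = 0 ↔ ν = onesPartition N := by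
  constructor
  · intro h
    have hN : N ≤ ν.parts.card := Nat.sub_eq_zero_iff_le.mp h
    have hone : ∀ x ∈ ν.parts, x = 1 := by
      intro x hx
      obtain ⟨s, hs⟩ := Multiset.exists_cons_of_mem hx
      have hsum := ν.parts_sum
      have hle : s.card ≤ s.sum := by
        simpa using Multiset.card_nsmul_le_sum (s := s) (a := 1) fun y hy =>
          ν.parts_pos (by rw [hs]; exact Multiset.mem_cons_of_mem hy)
      have := ν.parts_pos hx
      rw [hs] at hsum hN
      simp at hsum hN
      omega
    have hrep := Multiset.eq_replicate_card.2 hone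
    have hcard : ν.parts.card = N := by
      have := ν.parts_sum
      rw [hrep] at this
      simpa using this
    ext1
    rw [hrep, hcard]
    rfl
  · rintro rfl
    simp [colength, onesPartition]

/-- Averaging over `S_k` is redundant in the weight factor when summed against a symmetric
function. -/
theorem sum_weightFactor_mul {R : Type*} [CommRing R] [Algebra ℚ R] {L : ℕ} (c : Fin L → R)
    {N k : ℕ} (H : (Fin k → N.Partition) → ℚ)
    (hH : ∀ ν (σ : Equiv.Perm (Fin k)), H (ν ∘ σ) = H ν)
    (S : Finset (Fin k → N.Partition))
    (hS : ∀ ν (σ : Equiv.Perm (Fin k)), ν ∘ σ ∈ S ↔ ν ∈ S) :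
    ∑ ν ∈ S, weightFactor c ν * algebraMap ℚ R (H ν) =
      ∑ b ∈ Finset.univ.filter (fun b : Fin k → Fin L => StrictMono b),
        ∑ ν ∈ S, (∏ i, c (b i) ^ colength (ν i)) * algebraMap ℚ R (H ν) := by
  have key : ∀ σ : Equiv.Perm (Fin k), ∀ b : Fin k → Fin L,
      ∑ ν ∈ S, (∏ i, c (b (σ i)) ^ colength (ν i)) * algebraMap ℚ R (H ν) =
      ∑ ν ∈ S, (∏ i, c (b i) ^ colength (ν i)) * algebraMap ℚ R (H ν) := by
    intro σ b
    symm
    refine Finset.sum_equiv (σ.symm.arrowCongr (Equiv.refl _)) ?_ ?_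
    · intro ν
      exact (hS ν σ).symm
    · intro ν _
      congr 1
      · exact (Equiv.prod_comp σ (fun i => c (b i) ^ colength (ν i))).symm
      · exact congrArg _ (hH ν σ).symm
  have hb : (Finset.univ.filter fun b : Fin k → Fin L => ∀ i j : Fin k, i < j → b i < b j) =
      Finset.univ.filter (fun b : Fin k → Fin L => StrictMono b) := by
    ext b
    simp only [Finset.mem_filter, Finset.mem_univ, true_and]
    rfl
  simp only [weightFactor, hb, mul_assoc, ← Finset.mul_sum, Finset.sum_mul]
  rw [Finset.sum_comm]
  have hcomm : ∀ σ : Equiv.Perm (Fin k),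
      ∑ ν ∈ S, ∑ b ∈ Finset.univ.filter (fun b : Fin k → Fin L => StrictMono b),
        (∏ i, c (b (σ i)) ^ colength (ν i)) * algebraMap ℚ R (H ν) =
      ∑ b ∈ Finset.univ.filter (fun b : Fin k → Fin L => StrictMono b),
        ∑ ν ∈ S, (∏ i, c (b i) ^ colength (ν i)) * algebraMap ℚ R (H ν) := by
    intro σ
    rw [Finset.sum_comm]
    exact Finset.sum_congr rfl fun b _ => key σ b
  simp only [hcomm, Finset.sum_const, Finset.card_univ, Fintype.card_perm, Fintype.card_fin]
  rw [nsmul_eq_mul, ← mul_assoc, ← map_natCast (algebraMap ℚ R), ← map_mul,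
    inv_mul_cancel₀ (by exact_mod_cast k.factorial_ne_zero), map_one, one_mul]

/-- A family of symmetric functions of tuples depends only on the multiset of values. -/
theorem eq_of_ofFn_perm {α β : Type*} [LinearOrder α] (g : ∀ k, (Fin k → α) → β)
    (hg : ∀ k (ℓ : Fin k → α) (σ : Equiv.Perm (Fin k)), g k (ℓ ∘ σ) = g k ℓ)
    {k k' : ℕ} {ℓ : Fin k → α} {ℓ' : Fin k' → α} (h : (List.ofFn ℓ).Perm (List.ofFn ℓ')) :
    g k ℓ = g k' ℓ' := by
  obtain rfl : k = k' := by simpa using h.length_eq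
  rw [← hg k ℓ (Tuple.sort ℓ), ← hg k ℓ' (Tuple.sort ℓ')]
  congr 1
  refine List.ofFn_injective (List.Perm.eq_of_sortedLE (Tuple.monotone_sort ℓ).sortedLE_ofFn
    (Tuple.monotone_sort ℓ').sortedLE_ofFn ?_)
  exact (Equiv.Perm.ofFn_comp_perm _ ℓ).trans (h.trans (Equiv.Perm.ofFn_comp_perm _ ℓ').symm)

/-- The sum of `H` over tuples of partitions with prescribed colengths is symmetric. -/
theorem sum_colength_eq_comp_perm {N k : ℕ} (H : (Fin k → N.Partition) → ℚ)
    (hH : ∀ ν (σ : Equiv.Perm (Fin k)), H (ν ∘ σ) = H ν) (ℓ : Fin k → ℕ)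
    (σ : Equiv.Perm (Fin k)) :
    ∑ ν ∈ Finset.univ.filter (fun ν : Fin k → N.Partition => ∀ j, colength (ν j) = (ℓ ∘ σ) j),
      H ν =
    ∑ ν ∈ Finset.univ.filter (fun ν : Fin k → N.Partition => ∀ j, colength (ν j) = ℓ j),
      H ν := by
  symm
  refine Finset.sum_equiv (σ.symm.arrowCongr (Equiv.refl _)) ?_ ?_
  · intro ν
    simp only [Finset.mem_filter, Finset.mem_univ, true_and]
    exact (σ.forall_congr_right (q := fun j => colength (ν j) = ℓ j)).symm
  · intro ν _
    exact (hH ν σ).symm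

/-- The multiset over `Fin L` in which `b i` has multiplicity `ℓ i`. -/
def weightedMultiset {L k : ℕ} (b : Fin k → Fin L) (ℓ : Fin k → ℕ) : Multiset (Fin L) :=
  ∑ i, Multiset.replicate (ℓ i) (b i)

theorem count_weightedMultiset {L k : ℕ} {b : Fin k → Fin L} (hb : Function.Injective b)
    (ℓ : Fin k → ℕ) (i : Fin k) : (weightedMultiset b ℓ).count (b i) = ℓ i := by
  rw [weightedMultiset, Multiset.count_sum', Finset.sum_eq_single i]
  · simp
  · intro j _ hj
    rw [Multiset.count_replicate, if_neg fun h => hj (hb h)]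
  · simp

theorem toFinset_weightedMultiset {L k : ℕ} (b : Fin k → Fin L) {ℓ : Fin k → ℕ}
    (hℓ : ∀ i, ℓ i ≠ 0) : (weightedMultiset b ℓ).toFinset = Finset.univ.image b := by
  ext x
  simp [weightedMultiset, Multiset.mem_sum, Multiset.mem_replicate, hℓ, eq_comm]

theorem weightedMultiset_count {L k : ℕ} {s : Multiset (Fin L)} {b : Fin k → Fin L}
    (hb : Function.Injective b) (hs : s.toFinset = Finset.univ.image b) :
    weightedMultiset b (fun i => s.count (b i)) = s := by
  rw [weightedMultiset]
  conv_rhs => rw [← Multiset.toFinset_sum_count_nsmul_eq s, hs]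
  rw [Finset.sum_image hb.injOn]
  simp [Multiset.nsmul_singleton]

theorem card_weightedMultiset {L k : ℕ} (b : Fin k → Fin L) (ℓ : Fin k → ℕ) :
    (weightedMultiset b ℓ).card = ∑ i, ℓ i := by
  simp [weightedMultiset]

theorem prod_map_weightedMultiset {R : Type*} [CommRing R] {L k : ℕ} (c : Fin L → R)
    (b : Fin k → Fin L) (ℓ : Fin k → ℕ) :
    ((weightedMultiset b ℓ).map c).prod = ∏ i, c (b i) ^ ℓ i := by
  rw [weightedMultiset, ← Multiset.coe_mapAddMonoidHom, map_sum, Multiset.prod_sum]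
  simp

theorem dedup_map_count_weightedMultiset {L k : ℕ} {b : Fin k → Fin L}
    (hb : Function.Injective b) {ℓ : Fin k → ℕ} (hℓ : ∀ i, ℓ i ≠ 0) :
    (weightedMultiset b ℓ).dedup.map (weightedMultiset b ℓ).count = (List.ofFn ℓ : Multiset ℕ) := by
  have h : (weightedMultiset b ℓ).dedup = (Finset.univ.val : Multiset (Fin k)).map b := by
    rw [← Multiset.toFinset_val, toFinset_weightedMultiset b hℓ,
      Finset.image_val_of_injOn hb.injOn]
  rw [h, Multiset.map_map]
  simp only [Function.comp_def, count_weightedMultiset hb]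
  exact Fin.univ_val_map ℓ

theorem sum_strictMono_sum_eq_sum_sym {R : Type*} [CommRing R] {L : ℕ} (c : Fin L → R) {d : ℕ}
    (k : ℕ) (φ : ∀ k, (Fin k → ℕ) → R) (ψ : d.Partition → R)
    (h : ∀ (ℓ : Fin k → ℕ) (lam : d.Partition), (List.ofFn ℓ : Multiset ℕ) = lam.parts →
      φ k ℓ = ψ lam) :
    ∑ b ∈ Finset.univ.filter (fun b : Fin k → Fin L => StrictMono b),
      ∑ ℓ ∈ (Finset.finAntidiagonal k d).filter (fun ℓ => ∀ i, ℓ i ≠ 0),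
        (∏ i, c (b i) ^ ℓ i) * φ k ℓ =
    ∑ s ∈ Finset.univ.filter (fun s : Sym (Fin L) d => (s : Multiset (Fin L)).toFinset.card = k),
      ((s : Multiset (Fin L)).map c).prod * ψ (.ofSym s) := by
  rw [← Finset.sum_product']
  refine Finset.sum_bij (fun p hp => Sym.mk (weightedMultiset p.1 p.2) ?_) ?_ ?_ ?_ ?_
  · simp only [Finset.mem_product, Finset.mem_filter, Finset.mem_finAntidiagonal] at hp
    rw [card_weightedMultiset, hp.2.1]
  · rintro ⟨b, ℓ⟩ hp
    simp only [Finset.mem_product, Finset.mem_filter, Finset.mem_univ, true_and] at hp ⊢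
    rw [Sym.coe_mk, toFinset_weightedMultiset b hp.2.2, Finset.card_image_of_injective _ hp.1.injective]
    simp
  · rintro ⟨b, ℓ⟩ hp ⟨b', ℓ'⟩ hp' he
    simp only [Finset.mem_product, Finset.mem_filter, Finset.mem_univ, true_and] at hp hp'
    have he : weightedMultiset b ℓ = weightedMultiset b' ℓ' := congrArg Subtype.val he
    have hbb : b = b' := by
      rw [← hp.1.range_inj hp'.1]
      have := congrArg Multiset.toFinset he
      rw [toFinset_weightedMultiset b hp.2.2, toFinset_weightedMultiset b' hp'.2.2] at this
      simpa using congrArg (fun s : Finset (Fin L) => (s : Set (Fin L))) this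
    subst hbb
    congr 1
    ext i
    rw [← count_weightedMultiset hp.1.injective ℓ, he, count_weightedMultiset hp.1.injective]
  · rintro s hs
    simp only [Finset.mem_filter, Finset.mem_univ, true_and] at hs
    have himg : s.1.toFinset = Finset.univ.image (s.1.toFinset.orderEmbOfFin hs) := by
      rw [← Finset.coe_inj]; simp
    have hb := (s.1.toFinset.orderEmbOfFin hs).strictMono
    have hw := weightedMultiset_count hb.injective himg
    refine ⟨(s.1.toFinset.orderEmbOfFin hs, fun i => s.1.count (s.1.toFinset.orderEmbOfFin hs i)),
      ?_, Subtype.ext hw⟩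
    simp only [Finset.mem_product, Finset.mem_filter, Finset.mem_univ, true_and,
      Finset.mem_finAntidiagonal]
    refine ⟨hb, ?_, fun i => ?_⟩
    · rw [← card_weightedMultiset, hw]; exact s.2
    · rw [Multiset.count_ne_zero, ← Multiset.mem_toFinset]
      exact Finset.orderEmbOfFin_mem _ hs i
  · rintro ⟨b, ℓ⟩ hp
    simp only [Finset.mem_product, Finset.mem_filter, Finset.mem_univ, true_and] at hp
    rw [Sym.coe_mk, prod_map_weightedMultiset]
    congr 1
    exact h _ _ (dedup_map_count_weightedMultiset hp.1.injective hp.2.2).symm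

theorem sum_msymmEval_mul_s3 {R : Type*} [CommRing R] {L : ℕ} (c : Fin L → R) {d : ℕ}
    (ψ : d.Partition → R) :
    ∑ lam : d.Partition, msymmEval c lam * ψ lam =
      ∑ s : Sym (Fin L) d, ((s : Multiset (Fin L)).map c).prod * ψ (.ofSym s) := by
  rw [← Finset.sum_fiberwise Finset.univ (fun s : Sym (Fin L) d => Nat.Partition.ofSym s)]
  refine Finset.sum_congr rfl fun lam _ => ?_
  rw [msymmEval, MvPolynomial.msymm, map_sum, Finset.sum_mul]
  symm
  refine (Finset.sum_subtype (p := fun s : Sym (Fin L) d => Nat.Partition.ofSym s = lam)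
    _ (by simp) _).trans (Finset.sum_congr rfl ?_)
  rintro ⟨s, rfl⟩ -
  congr 1
  simp [map_multiset_prod, Multiset.map_map]

/-- The weighted sum of a symmetric family of functions on tuples of partitions, expressed through
monomial symmetric polynomials. -/
theorem sum_weightFactor_eq_sum_msymmEval {R : Type*} [CommRing R] [Algebra ℚ R] {L : ℕ}
    (c : Fin L → R) {N d : ℕ} (hd : 1 ≤ d) (H : ∀ k, (Fin k → N.Partition) → ℚ)
    (hH : ∀ k ν (σ : Equiv.Perm (Fin k)), H k (ν ∘ σ) = H k ν) :
    ∑ k ∈ Finset.Icc 1 d,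
      ∑ ν ∈ Finset.univ.filter (fun ν : Fin k → N.Partition =>
          (∀ i, ν i ≠ onesPartition N) ∧ ∑ i, colength (ν i) = d),
        weightFactor c ν * algebraMap ℚ R (H k ν) =
    ∑ lam : d.Partition, msymmEval c lam * algebraMap ℚ R
      (∑ ν ∈ Finset.univ.filter (fun ν : Fin (sortedParts lam).length → N.Partition =>
        ∀ j, colength (ν j) = (sortedParts lam).get j), H _ ν) := by
  set φ : ∀ k, (Fin k → ℕ) → ℚ := fun k ℓ =>
    ∑ ν ∈ Finset.univ.filter (fun ν : Fin k → N.Partition => ∀ j, colength (ν j) = ℓ j), H k ν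
    with hφ
  have hφlam : ∀ k (ℓ : Fin k → ℕ) (lam : d.Partition),
      (List.ofFn ℓ : Multiset ℕ) = lam.parts → φ k ℓ = φ _ (sortedParts lam).get := by
    intro k ℓ lam h
    refine eq_of_ofFn_perm φ (fun k => sum_colength_eq_comp_perm (H k) (hH k)) ?_
    rw [List.ofFn_get, ← Multiset.coe_eq_coe, h, sortedParts, Multiset.sort_eq]
  refine Eq.trans ?_ (sum_msymmEval_mul_s3 c
    (fun lam => algebraMap ℚ R (φ _ (sortedParts lam).get))).symm
  rw [← Finset.sum_fiberwise_of_maps_to (t := Finset.Icc 1 d)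
    (g := fun s : Sym (Fin L) d => (s : Multiset (Fin L)).toFinset.card)]
  · refine Finset.sum_congr rfl fun k _ => ?_
    rw [sum_weightFactor_mul c (H k) (hH k)]
    · rw [← sum_strictMono_sum_eq_sum_sym c k (fun k ℓ => algebraMap ℚ R (φ k ℓ)) _
        fun ℓ lam h => congrArg _ (hφlam k ℓ lam h)]
      refine Finset.sum_congr rfl fun b _ => ?_
      rw [← Finset.sum_fiberwise_of_maps_to
        (t := (Finset.finAntidiagonal k d).filter fun ℓ => ∀ i, ℓ i ≠ 0)
        (g := fun (ν : Fin k → N.Partition) i => colength (ν i))]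
      · refine Finset.sum_congr rfl fun ℓ hℓ => ?_
        simp only [Finset.mem_filter, Finset.mem_finAntidiagonal] at hℓ
        rw [hφ, map_sum, Finset.mul_sum]
        refine Finset.sum_congr ?_ fun ν hν => ?_
        · ext ν
          simp only [Finset.mem_filter, Finset.mem_univ, true_and, funext_iff, ne_eq,
            ← colength_eq_zero_iff]
          refine ⟨fun h => h.2, fun h => ⟨?_, h⟩⟩
          simpa only [h] using hℓ.symm
        · simp only [Finset.mem_filter, Finset.mem_univ, true_and] at hν
          simp only [hν]
      · intro ν hν
        simp only [Finset.mem_filter, Finset.mem_univ, true_and, ne_eq,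
          ← colength_eq_zero_iff, Finset.mem_finAntidiagonal] at hν ⊢
        exact hν.symm
    · intro ν σ
      simp only [Finset.mem_filter, Finset.mem_univ, true_and, Function.comp_apply]
      rw [Equiv.sum_comp σ (fun i => colength (ν i)),
        σ.forall_congr_right (q := fun i => ν i ≠ onesPartition N)]
  · intro s _
    have hcard : (s : Multiset (Fin L)).card = d := s.2
    rw [Finset.mem_Icc]
    refine ⟨?_, (Multiset.toFinset_card_le _).trans_eq hcard⟩
    rw [Nat.one_le_iff_ne_zero, Finset.card_ne_zero, Multiset.toFinset_nonempty]
    rintro h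
    rw [h] at hcard
    simp at hcard
    omega

end WHN

open WHN in
/-- The double sum `Σ_{k=1}^{d} Σ' 𝒲_G(μ⁽¹⁾,…,μ⁽ᵏ⁾) H(μ⁽¹⁾,…,μ⁽ᵏ⁾, μ)`, over `k`-tuples of
partitions of `N` each different from `(1^N)` with total colength `d`, equals
`Σ_{λ ⊢ d} m_λ(c) F_λ(μ)`; likewise for the connected pure Hurwitz numbers. -/
theorem statement3 {R : Type*} [CommRing R] [Algebra ℚ R] {L : ℕ} (hL : 1 ≤ L)
    (c : Fin L → R) {N : ℕ} (hN : 1 ≤ N) (μ : N.Partition) (d : ℕ) (hd : 1 ≤ d) :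
    (∑ k ∈ Finset.Icc 1 d,
        ∑ ν ∈ Finset.univ.filter (fun ν : Fin k → N.Partition =>
            (∀ i, ν i ≠ onesPartition N) ∧ ∑ i, colength (ν i) = d),
          weightFactor c ν * algebraMap ℚ R (pureHurwitz (Fin.snoc ν μ)))
      = weightedH c d μ ∧
    (∑ k ∈ Finset.Icc 1 d,
        ∑ ν ∈ Finset.univ.filter (fun ν : Fin k → N.Partition =>
            (∀ i, ν i ≠ onesPartition N) ∧ ∑ i, colength (ν i) = d),
          weightFactor c ν * algebraMap ℚ R (connHurwitz (Fin.snoc ν μ)))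
      = weightedHconn c d μ := by
  exact ⟨sum_weightFactor_eq_sum_msymmEval c hd (fun _ ν => pureHurwitz (Fin.snoc ν μ))
      fun _ ν σ => pureHurwitz_snoc_comp_perm μ ν σ,
    sum_weightFactor_eq_sum_msymmEval c hd (fun _ ν => connHurwitz (Fin.snoc ν μ))
      fun _ ν σ => connHurwitz_snoc_comp_perm μ ν σ⟩
end

section
/- (Riemann–Hurwitz bound for transitive factorizations.) Let N ≥ 1 and let μ⁽¹⁾,…,μ⁽ᵏ⁾ be partitions of N with Σ_{i=1}^{k} ℓ*(μ⁽ⁱ⁾) < 2N − 2. Then the connected pure Hurwitz number H̃(μ⁽¹⁾,…,μ⁽ᵏ⁾) = 0. Equivalently: if permutations h₁,…,h_k of {1,…,N} satisfy h₁⋯h_k = id and generate a subgroup acting transitively on {1,…,N}, then Σ_{i=1}^{k} (N − c(h_i)) ≥ 2N − 2, where c(h) is the number of cycles of h including fixed points. -/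
open scoped BigOperators

namespace Setoid

variable {α : Type*}

open Classical in
/-- The finest equivalence relation coarser than `s` that identifies `a` and `b`. -/
noncomputable def glue (s : Setoid α) (a b : α) : Setoid α :=
  ker fun x => if s x a then (Quotient.mk s b) else Quotient.mk s x

open Classical in
theorem glue_iff {s : Setoid α} {a b x y : α} : s.glue a b x y ↔
    (if s x a then (Quotient.mk s b) else Quotient.mk s x) =
      if s y a then (Quotient.mk s b) else Quotient.mk s y :=
  Iff.rfl

theorem le_glue (s : Setoid α) (a b : α) : s ≤ s.glue a b := by
  intro x y h
  have hxy : s x a ↔ s y a := ⟨fun hx => s.trans (s.symm h) hx, fun hy => s.trans h hy⟩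
  have : Quotient.mk s x = Quotient.mk s y := Quotient.sound h
  classical exact glue_iff.2 (if_congr hxy rfl this)

theorem glue_rel (s : Setoid α) (a b : α) : s.glue a b a b := by
  rw [glue_iff, if_pos (s.refl a)]
  split_ifs <;> rfl

theorem glue_le {s t : Setoid α} {a b : α} (hst : s ≤ t) (hab : t a b) : s.glue a b ≤ t := by
  intro x y h
  rw [glue_iff] at h
  split_ifs at h with hx hy hy
  · exact t.trans (hst hx) (t.symm (hst hy))
  · exact t.trans (hst hx) (t.trans hab (hst (Quotient.exact h)))
  · exact t.trans (hst (Quotient.exact h)) (t.trans (t.symm hab) (t.symm (hst hy)))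
  · exact hst (Quotient.exact h)

theorem glue_eq_self {s : Setoid α} {a b : α} (h : s a b) : s.glue a b = s :=
  le_antisymm (glue_le le_rfl h) (le_glue s a b)

theorem card_quotient_le [Finite α] {s t : Setoid α} (h : s ≤ t) :
    Nat.card (Quotient t) ≤ Nat.card (Quotient s) :=
  Nat.card_le_card_of_surjective (Quotient.map' id h) fun q =>
    Quotient.inductionOn q fun x => ⟨Quotient.mk s x, rfl⟩

theorem card_quotient_glue_add_one [Finite α] {s : Setoid α} {a b : α} (h : ¬ s a b) :
    Nat.card (Quotient (s.glue a b)) + 1 = Nat.card (Quotient s) := by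
  classical
  have hr : (Set.range fun x => if s x a then (Quotient.mk s b) else Quotient.mk s x) =
      {Quotient.mk s a}ᶜ := by
    ext q
    induction q using Quotient.inductionOn with | _ y
    simp only [Set.mem_range, Set.mem_compl_iff, Set.mem_singleton_iff, Quotient.eq]
    constructor
    · rintro ⟨x, hx⟩ hy
      split_ifs at hx with hxa
      · exact h (s.symm (s.trans (Quotient.exact hx) hy))
      · exact hxa (s.trans (Quotient.exact hx) hy)
    · intro hy
      exact ⟨y, if_neg hy⟩
  have := Fintype.ofFinite (Quotient s)
  rw [glue, Nat.card_congr (quotientKerEquivRange _), hr, Nat.card_coe_set_eq, add_comm,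
    ← Set.ncard_singleton (Quotient.mk s a), Set.ncard_add_ncard_compl]

theorem card_quotient_le_glue_add_one [Finite α] (s : Setoid α) (a b : α) :
    Nat.card (Quotient s) ≤ Nat.card (Quotient (s.glue a b)) + 1 := by
  by_cases h : s a b
  · rw [glue_eq_self h]; omega
  · exact (card_quotient_glue_add_one h).ge

end Setoid

namespace Equiv.Perm

variable {α : Type*} [DecidableEq α]

theorem glue_sameCycle_swap_mul_le [Finite α] (a b : α) (f : Perm α) :
    (SameCycle.setoid (swap a b * f)).glue a b ≤ (SameCycle.setoid f).glue a b := by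
  refine Setoid.glue_le ?_ (Setoid.glue_rel _ a b)
  set t := (SameCycle.setoid f).glue a b with ht
  have step : ∀ x, t x ((swap a b * f) x) := by
    intro x
    have hx : t x (f x) := Setoid.le_glue _ _ _ (sameCycle_apply_right.2 (SameCycle.refl f x))
    have hab : t a b := Setoid.glue_rel _ a b
    rw [mul_apply, swap_apply_def]
    split_ifs with h₁ h₂
    · exact t.trans (h₁ ▸ hx) hab
    · exact t.trans (h₂ ▸ hx) (t.symm hab)
    · exact hx
  intro x y hxy
  obtain ⟨n, rfl⟩ := SameCycle.exists_nat_pow_eq hxy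
  clear hxy
  induction n with
  | zero => exact t.refl x
  | succ n ih =>
    rw [pow_succ', mul_apply]
    exact t.trans ih (step _)

theorem glue_sameCycle_swap_mul [Finite α] (a b : α) (f : Perm α) :
    (SameCycle.setoid (swap a b * f)).glue a b = (SameCycle.setoid f).glue a b := by
  refine le_antisymm (glue_sameCycle_swap_mul_le a b f) ?_
  simpa using glue_sameCycle_swap_mul_le a b (swap a b * f)

theorem sameCycle_swap_mul_of_not_sameCycle [Finite α] {a b : α} {f : Perm α}
    (h : ¬ f.SameCycle a b) : (swap a b * f).SameCycle a b := by
  classical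
  have hex : ∃ n, 0 < n ∧ (f ^ n) a = a :=
    ⟨orderOf f, orderOf_pos f, by rw [pow_orderOf_eq_one, one_apply]⟩
  have key : ∀ j, j < Nat.find hex → ((swap a b * f) ^ j) a = (f ^ j) a := by
    intro j
    induction j with
    | zero => simp
    | succ j ih =>
      intro hj
      have hne : (f ^ (j + 1)) a ≠ a := fun hc => Nat.find_min hex hj ⟨j.succ_pos, hc⟩
      have hnb : (f ^ (j + 1)) a ≠ b := fun hc => h ⟨(j + 1 : ℕ), by rw [zpow_natCast, hc]⟩
      rw [pow_succ', mul_apply, ih (by omega), mul_apply, ← mul_apply f, ← pow_succ',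
        swap_apply_of_ne_of_ne hne hnb]
  obtain ⟨hpos, hfix⟩ := Nat.find_spec hex
  refine ⟨(Nat.find hex : ℕ), ?_⟩
  obtain ⟨m, hm⟩ := Nat.exists_eq_succ_of_ne_zero hpos.ne'
  rw [zpow_natCast, hm, pow_succ', mul_apply, key m (by omega), mul_apply, ← mul_apply f,
    ← pow_succ', ← Nat.succ_eq_add_one, ← hm, hfix, swap_apply_left]

/-- The product of the transpositions prescribed by a list of pairs. -/
def swapsProd (l : List (α × α)) : Perm α :=
  (l.map fun p => swap p.1 p.2).prod

theorem swapsProd_append (l m : List (α × α)) :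
    swapsProd (l ++ m) = swapsProd l * swapsProd m := by
  simp [swapsProd]

theorem swapsProd_flatMap {ι : Type*} (I : List ι) (w : ι → List (α × α)) :
    swapsProd (I.flatMap w) = (I.map fun i => swapsProd (w i)).prod := by
  induction I with
  | nil => rfl
  | cons i I ih => rw [List.flatMap_cons, swapsProd_append, ih, List.map_cons, List.prod_cons]

/-- The equivalence relation generated by a list of pairs. -/
noncomputable def swapsSetoid {α : Type*} (l : List (α × α)) : Setoid α :=
  l.foldr (fun p s => s.glue p.1 p.2) ⊥

theorem swapsSetoid_le_iff {α : Type*} {l : List (α × α)} {t : Setoid α} :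
    swapsSetoid l ≤ t ↔ ∀ p ∈ l, t p.1 p.2 := by
  induction l with
  | nil => simp [swapsSetoid]
  | cons p l ih =>
    rw [List.forall_mem_cons, ← ih]
    constructor
    · intro h
      exact ⟨h (Setoid.glue_rel _ _ _), (Setoid.le_glue _ _ _).trans h⟩
    · rintro ⟨hp, hl⟩
      exact Setoid.glue_le hl hp

theorem swapsSetoid_apply (l : List (α × α)) (x : α) : swapsSetoid l (swapsProd l x) x := by
  induction l with
  | nil => exact Setoid.refl' _ x
  | cons p l ih =>
    set s := swapsSetoid (p :: l) with hs
    have hab : s p.1 p.2 := Setoid.glue_rel _ _ _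
    have h : s (swapsProd l x) x := Setoid.le_glue _ _ _ ih
    have hp : swapsProd (p :: l) = swap p.1 p.2 * swapsProd l := by simp [swapsProd]
    rw [hp, mul_apply, swap_apply_def]
    split_ifs with h₁ h₂
    · exact s.trans (s.symm hab) (h₁ ▸ h)
    · exact s.trans hab (h₂ ▸ h)
    · exact h

theorem card_add_card_sameCycle_le [Finite α] (l : List (α × α)) :
    Nat.card α + Nat.card (Quotient (SameCycle.setoid (swapsProd l))) ≤
      l.length + 2 * Nat.card (Quotient (swapsSetoid l)) := by
  induction l with
  | nil =>
    have h₁ : Nat.card α ≤ Nat.card (Quotient (swapsSetoid ([] : List (α × α)))) :=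
      Nat.card_le_card_of_injective (Quotient.mk _) fun _ _ hxy => Quotient.exact hxy
    have h₂ : Nat.card (Quotient (SameCycle.setoid (swapsProd ([] : List (α × α))))) ≤
        Nat.card α :=
      Nat.card_le_card_of_surjective _ Quotient.mk_surjective
    rw [List.length_nil]
    omega
  | cons p l ih =>
    obtain ⟨a, b⟩ := p
    have hp : swapsProd ((a, b) :: l) = swap a b * swapsProd l := by simp [swapsProd]
    have hs : swapsSetoid ((a, b) :: l) = (swapsSetoid l).glue a b := rfl
    have hJ := glue_sameCycle_swap_mul a b (swapsProd l)
    rw [hp, hs, List.length_cons]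
    by_cases h : swapsSetoid l a b
    · rw [Setoid.glue_eq_self h]
      have h₁ := Setoid.card_quotient_le_glue_add_one
        (SameCycle.setoid (swap a b * swapsProd l)) a b
      rw [hJ] at h₁
      have h₂ := Setoid.card_quotient_le (Setoid.le_glue (SameCycle.setoid (swapsProd l)) a b)
      omega
    · have hle : SameCycle.setoid (swapsProd l) ≤ swapsSetoid l := by
        intro x y hxy
        obtain ⟨n, rfl⟩ := SameCycle.exists_nat_pow_eq hxy
        clear hxy
        induction n with
        | zero => exact Setoid.refl' _ x
        | succ n ihn =>
          rw [pow_succ', mul_apply]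
          exact Setoid.trans' _ ihn (Setoid.symm' _ (swapsSetoid_apply l _))
      have hn : ¬ (swapsProd l).SameCycle a b := fun hc => h (hle hc)
      have h₁ := Setoid.card_quotient_glue_add_one (s := SameCycle.setoid (swapsProd l)) hn
      have h₂ := Setoid.card_quotient_glue_add_one h
      rw [← hJ, Setoid.glue_eq_self (sameCycle_swap_mul_of_not_sameCycle hn)] at h₁
      omega

theorem formPerm_eq_swapsProd (l : List α) : l.formPerm = swapsProd (l.zip l.tail) := by
  rw [List.formPerm, swapsProd, List.zip, List.map_zipWith]

theorem exists_swapsProd_eq [Fintype α] (f : Perm α) :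
    ∃ l : List (α × α), swapsProd l = f ∧ l.length + f.cycleType.card = f.cycleType.sum := by
  induction f using cycle_induction_on with
  | base_one => exact ⟨[], by simp [swapsProd]⟩
  | base_cycles σ hσ =>
    obtain ⟨x, hx, -⟩ := id hσ
    refine ⟨(toList σ x).zip (toList σ x).tail, ?_, ?_⟩
    · rw [← formPerm_eq_swapsProd, formPerm_toList, hσ.cycleOf_eq hx]
    · have h2 := hσ.two_le_card_support
      rw [hσ.cycleType, List.length_zip, List.length_tail, length_toList, hσ.cycleOf_eq hx]
      simp
      omega
  | induction_disjoint σ τ hd _ hσ hτ =>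
    obtain ⟨l, rfl, hl⟩ := hσ
    obtain ⟨m, rfl, hm⟩ := hτ
    refine ⟨l ++ m, swapsProd_append l m, ?_⟩
    rw [hd.cycleType_mul, List.length_append, Multiset.card_add, Multiset.sum_add]
    omega

theorem two_mul_card_le_of_prod_eq_one {ι : Type*} [Finite α] [Nonempty α] (I : List ι)
    (h : ι → Perm α) (w : ι → List (α × α)) (hw : ∀ i, swapsProd (w i) = h i)
    (hprod : (I.map h).prod = 1)
    (htrans : ∀ x y : α, ∃ g ∈ Subgroup.closure (h '' {i | i ∈ I}), g x = y) :
    2 * Nat.card α ≤ (I.map fun i => (w i).length).sum + 2 := by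
  set L := I.flatMap w with hL
  have hLprod : swapsProd L = 1 := by
    simp only [hL, swapsProd_flatMap, hw, hprod]
  have hLlen : L.length = (I.map fun i => (w i).length).sum := by
    rw [hL, List.length_flatMap]
  have hgen : ∀ g ∈ Subgroup.closure (h '' {i | i ∈ I}), ∀ x, swapsSetoid L (g x) x := by
    intro g hg
    induction hg using Subgroup.closure_induction with
    | mem g hg =>
      obtain ⟨i, hi, rfl⟩ := hg
      intro x
      have hle : swapsSetoid (w i) ≤ swapsSetoid L := swapsSetoid_le_iff.2 fun p hp =>
        swapsSetoid_le_iff.1 le_rfl p (List.mem_flatMap.2 ⟨i, hi, hp⟩)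
      rw [← hw i]
      exact hle (swapsSetoid_apply _ x)
    | one => exact fun x => Setoid.refl' _ x
    | mul g g' _ _ hg hg' => exact fun x => Setoid.trans' _ (hg (g' x)) (hg' x)
    | inv g _ hg =>
      intro x
      simpa using Setoid.symm' _ (hg (g⁻¹ x))
  have hsub : Subsingleton (Quotient (swapsSetoid L)) := by
    refine ⟨fun p q => Quotient.inductionOn₂ p q fun x y => ?_⟩
    obtain ⟨g, hg, rfl⟩ := htrans x y
    exact Quotient.sound (Setoid.symm' _ (hgen g hg x))
  have hone : Nat.card (Quotient (swapsSetoid L)) ≤ 1 := Finite.card_le_one_iff_subsingleton.2 hsub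
  have hcyc : Nat.card α ≤ Nat.card (Quotient (SameCycle.setoid (swapsProd L))) := by
    refine Nat.card_le_card_of_injective (Quotient.mk _) fun x y hxy => ?_
    have : (swapsProd L).SameCycle x y := Quotient.exact hxy
    rwa [hLprod, sameCycle_one] at this
  have := card_add_card_sameCycle_le L
  omega

end Equiv.Perm

namespace WHN

theorem two_mul_sub_two_le_of_prod_eq_one {N k : ℕ} (hN : 1 ≤ N) (h : Fin k → Equiv.Perm (Fin N))
    (hprod : (List.ofFn h).prod = 1)
    (htrans : ∀ x y : Fin N, ∃ g ∈ Subgroup.closure (Set.range h), g x = y) :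
    2 * N - 2 ≤ ∑ i, (N - numCycles (h i)) := by
  have : Nonempty (Fin N) := ⟨⟨0, hN⟩⟩
  choose w hw hlen using fun i => Equiv.Perm.exists_swapsProd_eq (h i)
  have hlen' : ∀ i, (w i).length = N - numCycles (h i) := by
    intro i
    have h₁ := hlen i
    have h₂ := (h i).sum_cycleType_le
    rw [Fintype.card_fin] at h₂
    simp only [numCycles, fullCycleType, Multiset.card_add, Multiset.card_replicate]
    omega
  have key := Equiv.Perm.two_mul_card_le_of_prod_eq_one (List.finRange k) h w hw
    (by rwa [← List.ofFn_eq_map]) (by simpa using htrans)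
  rw [Nat.card_fin, ← List.ofFn_eq_map, List.sum_ofFn] at key
  simp only [hlen'] at key
  omega

theorem connHurwitz_eq_zero_of_sum_colength_lt {N k : ℕ} (hN : 1 ≤ N) (μ : Fin k → N.Partition)
    (hμ : ∑ i, colength (μ i) < 2 * N - 2) : connHurwitz μ = 0 := by
  have hempty : IsEmpty {h : Fin k → Equiv.Perm (Fin N) //
      (∀ i, fullCycleType (h i) = (μ i).parts) ∧ (List.ofFn h).prod = 1 ∧
      ∀ x y : Fin N, ∃ g ∈ Subgroup.closure (Set.range h), g x = y} := by
    refine ⟨fun ⟨h, htype, hprod, htrans⟩ => ?_⟩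
    have hle := two_mul_sub_two_le_of_prod_eq_one hN h hprod htrans
    simp only [numCycles, htype] at hle
    exact absurd hμ (not_lt.2 hle)
  rw [connHurwitz, Nat.card_of_isEmpty, Nat.cast_zero, zero_div]

end WHN

open WHN in
/-- Riemann–Hurwitz bound for transitive factorizations: if `Σ_i ℓ*(μ⁽ⁱ⁾) < 2N − 2` then
`H̃(μ⁽¹⁾,…,μ⁽ᵏ⁾) = 0`.  Equivalently, if `h₁ ⋯ h_k = id` and `h₁, …, h_k` generate a
transitive subgroup, then `Σ_i (N − c(h_i)) ≥ 2N − 2`, where `c(h)` counts the cycles of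
`h` including fixed points. -/
theorem statement9 {N k : ℕ} (hN : 1 ≤ N) :
    (∀ μ : Fin k → N.Partition, (∑ i, colength (μ i)) < 2 * N - 2 → connHurwitz μ = 0) ∧
    (∀ h : Fin k → Equiv.Perm (Fin N), (List.ofFn h).prod = 1 →
      (∀ x y : Fin N, ∃ g ∈ Subgroup.closure (Set.range h), g x = y) →
      2 * N - 2 ≤ ∑ i, (N - numCycles (h i))) :=
  ⟨connHurwitz_eq_zero_of_sum_colength_lt hN, two_mul_sub_two_le_of_prod_eq_one hN⟩
end

section
/- (Riemann–Hurwitz vanishing of connected weighted Hurwitz numbers.) Let μ be a partition of N and d ≥ 0 an integer with d < |μ| + ℓ(μ) − 2. Then the connected weighted Hurwitz number H̃^d_G(μ) = 0. -/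
open scoped BigOperators

namespace WHN

open Equiv Module

section PermutationRepresentation

variable {α : Type*}

/-- The permutation representation of `Perm α` on the functions `α → ℚ`. -/
def permRep (α : Type*) : Perm α →* End ℚ (α → ℚ) where
  toFun g := LinearMap.funLeft ℚ ℚ ⇑g⁻¹
  map_one' := rfl
  map_mul' _ _ := rfl

theorem permRep_apply (g : Perm α) (f : α → ℚ) (x : α) : permRep α g f x = f (g⁻¹ x) := rfl

theorem permRep_single [DecidableEq α] (g : Perm α) (x : α) :
    permRep α g (Pi.single x 1) = Pi.single (g x) 1 := by
  ext y
  simp only [permRep_apply, Pi.single_apply, Perm.inv_eq_iff_eq]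

/-- The rank of `1 - g` in the permutation representation. -/
noncomputable def displacementRank (g : Perm α) : ℕ :=
  finrank ℚ (1 - permRep α g).range

theorem displacementRank_one : displacementRank (1 : Perm α) = 0 := by
  rw [displacementRank, map_one, sub_self, LinearMap.range_zero, finrank_bot]

theorem displacementRank_mul_le [Finite α] (g h : Perm α) :
    displacementRank (g * h) ≤ displacementRank g + displacementRank h := by
  refine (Submodule.finrank_mono ?_).trans (Submodule.finrank_add_le_finrank_add_finrank _ _)
  rintro _ ⟨v, rfl⟩
  refine Submodule.mem_sup.2 ⟨_, ⟨permRep α h v, rfl⟩, _, ⟨v, rfl⟩, ?_⟩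
  simp

theorem displacementRank_swap_le [Finite α] [DecidableEq α] (x y : α) :
    displacementRank (swap x y) ≤ 1 := by
  refine le_trans (Submodule.finrank_mono ?_)
    (finrank_span_le_card ({Pi.single x 1 - Pi.single y 1} : Set (α → ℚ)))
  rintro _ ⟨v, rfl⟩
  refine Submodule.mem_span_singleton.2 ⟨v x - v y, ?_⟩
  ext z
  simp only [LinearMap.sub_apply, End.one_apply, Pi.smul_apply, Pi.sub_apply, permRep_apply,
    swap_inv, Pi.single_apply, smul_eq_mul, swap_apply_def]
  split_ifs <;> simp_all

theorem displacementRank_formPerm_le [Finite α] [DecidableEq α] (l : List α) :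
    displacementRank l.formPerm ≤ l.length - 1 := by
  induction l with
  | nil => simp [displacementRank_one]
  | cons x l ih =>
    cases l with
    | nil => simp [displacementRank_one]
    | cons y l =>
      rw [List.formPerm_cons_cons]
      refine (displacementRank_mul_le _ _).trans ?_
      have := displacementRank_swap_le x y
      simp only [List.length_cons] at ih ⊢
      lia

theorem displacementRank_add_card_cycleType_le [Fintype α] [DecidableEq α] (g : Perm α) :
    displacementRank g + g.cycleType.card ≤ g.support.card := by
  induction g using Perm.cycle_induction_on with
  | base_one => simp [displacementRank_one]
  | base_cycles g hg =>
    obtain ⟨x, hx, -⟩ := id hg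
    have h := displacementRank_formPerm_le (g.toList x)
    rw [Perm.formPerm_toList, Perm.length_toList, hg.cycleOf_eq hx] at h
    have := hg.two_le_card_support
    rw [hg.cycleType, Multiset.card_singleton]
    lia
  | induction_disjoint g h hd _ ihg ihh =>
    rw [hd.cycleType_mul, hd.card_support_mul, Multiset.card_add]
    have := displacementRank_mul_le g h
    lia

end PermutationRepresentation

theorem displacementRank_le_colength {N : ℕ} {g : Perm (Fin N)} {ν : N.Partition}
    (h : fullCycleType g = ν.parts) : displacementRank g ≤ colength ν := by
  have h₁ := displacementRank_add_card_cycleType_le g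
  have h₂ := g.support.card_le_univ
  rw [Fintype.card_fin] at h₂
  rw [colength, ← h, fullCycleType, Multiset.card_add, Multiset.card_replicate,
    Perm.sum_cycleType]
  lia

section Transitive

variable {N m : ℕ} (h : Fin m → Perm (Fin N))

/-- The product `h₀ ⋯ hᵢ₋₁` of the first `i` members of a tuple of permutations. -/
def prefixProd (i : ℕ) : Perm (Fin N) := ((List.ofFn h).take i).prod

theorem prefixProd_zero : prefixProd h 0 = 1 := by simp [prefixProd]

theorem prefixProd_length : prefixProd h m = (List.ofFn h).prod := by
  rw [prefixProd, List.take_of_length_le (by simp)]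

theorem prefixProd_succ (i : Fin m) : prefixProd h (i + 1) = prefixProd h i * h i := by
  rw [prefixProd, List.prod_take_succ _ _ (by simp)]
  simp [prefixProd]

/-- The common displacement map `v ↦ ((1 - hᵢ) v)ᵢ`. -/
noncomputable def displacementMap :
    (Fin N → ℚ) →ₗ[ℚ] (Π i, (1 - permRep (Fin N) (h i)).range) :=
  LinearMap.pi fun i => (1 - permRep (Fin N) (h i)).rangeRestrict

/-- The map `(vᵢ)ᵢ ↦ ∑ᵢ h₀ ⋯ hᵢ₋₁ vᵢ`. -/
noncomputable def displacementSum :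
    (Π i, (1 - permRep (Fin N) (h i)).range) →ₗ[ℚ] (Fin N → ℚ) :=
  ∑ i : Fin m, permRep (Fin N) (prefixProd h i) ∘ₗ Submodule.subtype _ ∘ₗ LinearMap.proj i

theorem displacementSum_displacementMap (v : Fin N → ℚ) :
    displacementSum h (displacementMap h v) = v - permRep _ (List.ofFn h).prod v := by
  have key (i : Fin m) : permRep _ (prefixProd h i) ((1 - permRep _ (h i)) v) =
      permRep _ (prefixProd h i) v - permRep _ (prefixProd h (i + 1)) v := by
    rw [prefixProd_succ]
    simp
  simp only [displacementSum, displacementMap, LinearMap.sum_apply, LinearMap.comp_apply,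
    LinearMap.proj_apply, LinearMap.pi_apply, Submodule.subtype_apply,
    LinearMap.codRestrict_apply, LinearMap.rangeRestrict, key]
  rw [Fin.sum_univ_eq_sum_range
    (fun i => permRep _ (prefixProd h i) v - permRep _ (prefixProd h (i + 1)) v),
    Finset.sum_range_sub' (fun i => permRep _ (prefixProd h i) v), prefixProd_zero,
    prefixProd_length]
  simp

theorem permRep_prefixProd_sub_mem_range (i : Fin m) (v : Fin N → ℚ) :
    permRep _ (prefixProd h i) v - permRep _ (prefixProd h (i + 1)) v ∈
      (displacementSum h).range := by
  refine ⟨Pi.single i ⟨(1 - permRep _ (h i)) v, v, rfl⟩, ?_⟩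
  rw [displacementSum, LinearMap.sum_apply, Finset.sum_eq_single i]
  · rw [prefixProd_succ]
    simp
  · intro j _ hj
    simp [Pi.single_eq_of_ne hj]
  · simp

/-- The permutations acting trivially on the quotient of the permutation representation by `D`,
where `D` is any subspace. -/
def quotientFixing (D : Submodule ℚ (Fin N → ℚ)) : Subgroup (Perm (Fin N)) where
  carrier := {g | ∀ v, v - permRep _ g v ∈ D}
  one_mem' v := by simp
  mul_mem' {a b} ha hb v := by
    have := D.add_mem (hb v) (ha (permRep _ b v))
    simpa using this
  inv_mem' {a} ha v := by
    have := D.neg_mem (ha (permRep _ a⁻¹ v))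
    rwa [← End.mul_apply, ← map_mul, mul_inv_cancel, map_one, End.one_apply, neg_sub] at this

theorem closure_le_quotientFixing :
    Subgroup.closure (Set.range h) ≤ quotientFixing (displacementSum h).range := by
  set D := (displacementSum h).range with hD
  have hP : ∀ i ≤ m, prefixProd h i ∈ quotientFixing D := by
    intro i
    induction i with
    | zero => exact fun _ => prefixProd_zero h ▸ one_mem _
    | succ i ih =>
      intro hi v
      have := D.add_mem (ih (by lia) v) (permRep_prefixProd_sub_mem_range h ⟨i, hi⟩ v)
      simpa using this
  rw [Subgroup.closure_le]
  rintro _ ⟨i, rfl⟩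
  have hi : h i = (prefixProd h i)⁻¹ * prefixProd h (i + 1) := by
    rw [prefixProd_succ, inv_mul_cancel_left]
  rw [hi]
  exact mul_mem (inv_mem (hP _ i.2.le)) (hP _ i.2)

variable {h}

theorem le_finrank_range_displacementSum
    (ht : ∀ x y : Fin N, ∃ g ∈ Subgroup.closure (Set.range h), g x = y) :
    N ≤ finrank ℚ (displacementSum h).range + 1 := by
  obtain rfl | hN := N.eq_zero_or_pos
  · simp
  let x : Fin N := ⟨0, hN⟩
  have htop : (displacementSum h).range ⊔ Submodule.span ℚ {Pi.single x 1} = ⊤ := by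
    rw [eq_top_iff, ← (Pi.basisFun ℚ (Fin N)).span_eq, Submodule.span_le]
    rintro _ ⟨y, rfl⟩
    obtain ⟨g, hg, rfl⟩ := ht x y
    have hmem := closure_le_quotientFixing h hg (Pi.single x 1)
    rw [permRep_single] at hmem
    rw [Pi.basisFun_apply]
    refine Submodule.mem_sup.2 ⟨_, neg_mem hmem, _, Submodule.mem_span_singleton_self _, ?_⟩
    simp
  have := Submodule.finrank_add_le_finrank_add_finrank (displacementSum h).range
    (Submodule.span ℚ {Pi.single x 1})
  rw [htop, finrank_top, finrank_fin_fun] at this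
  exact this.trans (Nat.add_le_add_left (finrank_span_le_card _) _)

theorem finrank_ker_displacementMap_le
    (ht : ∀ x y : Fin N, ∃ g ∈ Subgroup.closure (Set.range h), g x = y) :
    finrank ℚ (displacementMap h).ker ≤ 1 := by
  refine le_trans (Submodule.finrank_mono ?_)
    (finrank_span_le_card ({fun _ => 1} : Set (Fin N → ℚ)))
  intro v hv
  have hfix : Subgroup.closure (Set.range h) ≤ (MulAction.stabilizer (End ℚ (Fin N → ℚ))ˣ v).comap
      (permRep (Fin N)).toHomUnits := by
    rw [Subgroup.closure_le]
    rintro _ ⟨i, rfl⟩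
    have := congrArg Subtype.val (congrFun hv i)
    exact (sub_eq_zero.1 this).symm
  have hconst (x y : Fin N) : v x = v y := by
    obtain ⟨g, hg, rfl⟩ := ht x y
    have hg' : permRep _ g v = v := hfix hg
    have := congrFun hg' (g x)
    simpa [permRep_apply] using this
  refine Submodule.mem_span_singleton.2 ?_
  obtain rfl | hN := N.eq_zero_or_pos
  · exact ⟨0, Subsingleton.elim _ _⟩
  · exact ⟨v ⟨0, hN⟩, funext fun y => by simpa using hconst _ y⟩

/-- The Riemann–Hurwitz inequality for a transitive tuple of permutations with product `1`. -/
theorem two_mul_le_sum_displacementRank (hprod : (List.ofFn h).prod = 1)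
    (ht : ∀ x y : Fin N, ∃ g ∈ Subgroup.closure (Set.range h), g x = y) :
    2 * N ≤ ∑ i, displacementRank (h i) + 2 := by
  have hle : (displacementMap h).range ≤ (displacementSum h).ker := by
    rintro _ ⟨v, rfl⟩
    simp [displacementSum_displacementMap, hprod]
  have h₁ := (displacementMap h).finrank_range_add_finrank_ker
  have h₂ := (displacementSum h).finrank_range_add_finrank_ker
  have h₃ := Submodule.finrank_mono hle
  have h₄ := le_finrank_range_displacementSum ht
  have h₅ := finrank_ker_displacementMap_le ht
  rw [finrank_fin_fun] at h₁
  rw [finrank_pi_fintype] at h₂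
  simp only [displacementRank]
  lia

end Transitive

theorem connHurwitz_eq_zero {N k : ℕ} (μ : Fin k → N.Partition)
    (hlt : ∑ i, colength (μ i) + 2 < 2 * N) : connHurwitz μ = 0 := by
  have : IsEmpty {h : Fin k → Perm (Fin N) //
      (∀ i, fullCycleType (h i) = (μ i).parts) ∧ (List.ofFn h).prod = 1 ∧
      ∀ x y : Fin N, ∃ g ∈ Subgroup.closure (Set.range h), g x = y} := by
    refine ⟨fun ⟨h, htype, hprod, ht⟩ => ?_⟩
    have h₁ := two_mul_le_sum_displacementRank hprod ht
    have h₂ : ∑ i, displacementRank (h i) ≤ ∑ i, colength (μ i) :=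
      Finset.sum_le_sum fun i _ => displacementRank_le_colength (htype i)
    lia
  simp [connHurwitz]

theorem Fconn_eq_zero {N k : ℕ} (μ : N.Partition) (ℓ : Fin k → ℕ)
    (hlt : ∑ j, ℓ j + colength μ + 2 < 2 * N) : Fconn N μ ℓ = 0 := by
  refine Finset.sum_eq_zero fun ν hν => connHurwitz_eq_zero _ ?_
  rw [Fin.sum_univ_castSucc]
  simp only [Fin.snoc_castSucc, Fin.snoc_last, (Finset.mem_filter.1 hν).2]
  exact hlt

theorem sum_get_sortedParts {d : ℕ} (lam : d.Partition) :
    ∑ j, (sortedParts lam).get j = d := by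
  rw [← List.sum_ofFn, List.ofFn_get, ← Multiset.sum_coe, sortedParts, Multiset.sort_eq,
    lam.parts_sum]

theorem card_parts_le {N : ℕ} (μ : N.Partition) : μ.parts.card ≤ N := by
  have := Multiset.card_nsmul_le_sum (s := μ.parts) (a := 1) fun _ hx => μ.parts_pos hx
  simpa [μ.parts_sum] using this

end WHN

open WHN in
/-- Riemann–Hurwitz vanishing: if `d < |μ| + ℓ(μ) − 2` then the connected weighted Hurwitz
number `H̃^d_G(μ)` vanishes. -/
theorem statement15 {R : Type*} [CommRing R] [Algebra ℚ R] {L : ℕ} (hL : 1 ≤ L)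
    (c : Fin L → R) {N : ℕ} (hN : 1 ≤ N) (μ : N.Partition) (d : ℕ)
    (hd : d < N + μ.parts.card - 2) :
    weightedHconn c d μ = 0 := by
  refine Finset.sum_eq_zero fun lam _ => ?_
  have hμ := card_parts_le μ
  rw [Fconn_eq_zero, map_zero, mul_zero]
  rw [sum_get_sortedParts, colength]
  lia
end
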